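/- arXiv:math/0202090 — 3 statements merged into one kernel-verified Lean document; each statement's English description precedes it below -/
import Mathlib

section
/- For every w ∈ Σ_n, the Schubert polynomial satisfies S_w(x) = Σ_{γ ∈ Γ(w,w₀)} x^δ/x^γ, the sum over all increasing chains γ in the labeled Bruhat order from w to the longest permutation w₀; in particular, for each such chain γ the monomial x^γ divides x^δ. -/
open MvPolynomial

noncomputable section

/-- The symmetric group `Σ_n` on `{0, …, n-1}` (0-indexed model of `{1, …, n}`). -/
abbrev Perm' (n : ℕ) := Equiv.Perm (Fin n)

/-- The length `ℓ(w)`: the number of inversions of `w`. -/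
def invLength {n : ℕ} (w : Perm' n) : ℕ :=
  (Finset.univ.filter (fun p : Fin n × Fin n => p.1 < p.2 ∧ w p.2 < w p.1)).card

/-- The longest permutation `w₀ = n … 2 1`. -/
def w0 (n : ℕ) : Perm' n := Fin.revPerm

/-- `u ⋖ w` in the Bruhat order: `w = u·(k,l)` where `k < l`, `u k < u l`, and no
position strictly between `k` and `l` has a `u`-value between `u k` and `u l`. -/
def BruhatCover {n : ℕ} (u w : Perm' n) : Prop :=
  ∃ k l : Fin n, k < l ∧ u k < u l ∧
    (∀ i : Fin n, k < i → i < l → ¬(u k < u i ∧ u i < u l)) ∧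
    w = u * Equiv.swap k l

/-- The Bruhat order, generated by its covers. -/
def BruhatLE {n : ℕ} : Perm' n → Perm' n → Prop :=
  Relation.ReflTransGen BruhatCover

/-- `u →^{(k,b)} w` is a labeled cover in the labeled Bruhat order (0-indexed):
`u ⋖ w` with `u⁻¹w = (i,j)`, `i ≤ k < j` and `b = u i`. -/
def IsLabeledCover {n : ℕ} (u w : Perm' n) (k b : ℕ) : Prop :=
  ∃ i j : Fin n, i < j ∧ u i < u j ∧
    (∀ m : Fin n, i < m → m < j → ¬(u i < u m ∧ u m < u j)) ∧
    w = u * Equiv.swap i j ∧ (i : ℕ) ≤ k ∧ k < (j : ℕ) ∧ b = (u i : ℕ)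

/-- Strict lexicographic order on labels `(k,b)`. -/
def lexLt (p q : ℕ × ℕ) : Prop := p.1 < q.1 ∨ (p.1 = q.1 ∧ p.2 < q.2)

/-- A saturated labeled chain of length `m` from `u` to `w` in the labeled Bruhat order. -/
structure LabeledChain (n m : ℕ) (u w : Perm' n) where
  c : Fin (m + 1) → Perm' n
  lab : Fin m → ℕ × ℕ
  c_zero : c 0 = u
  c_last : c (Fin.last m) = w
  step : ∀ i : Fin m, IsLabeledCover (c i.castSucc) (c i.succ) (lab i).1 (lab i).2

/-- A chain is increasing if its labels strictly increase in lexicographic order. -/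
def LabeledChain.Increasing {n m : ℕ} {u w : Perm' n} (γ : LabeledChain n m u w) : Prop :=
  ∀ i j : Fin m, i < j → lexLt (γ.lab i) (γ.lab j)

/-- The type of a chain: `α_k` counts labels with first coordinate `k`. -/
def chainType {n m : ℕ} {u w : Perm' n} (γ : LabeledChain n m u w) : Fin n → ℕ :=
  fun k => (Finset.univ.filter (fun i : Fin m => (γ.lab i).1 = (k : ℕ))).card

/-- `I_α(u,w)`: the number of increasing chains from `u` to `w` of type `α`. -/
def incChainCount (n : ℕ) (u w : Perm' n) (α : Fin n → ℕ) : ℕ :=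
  Nat.card ((m : ℕ) × {γ : LabeledChain n m u w // γ.Increasing ∧ chainType γ = α})

/-- The staircase monomial `x^δ = x₁^{n-1} x₂^{n-2} ⋯ x_{n-1}`. -/
def xDelta (n : ℕ) : MvPolynomial (Fin n) ℤ :=
  ∏ i : Fin n, X i ^ (n - 1 - (i : ℕ))

/-- `S` is the family of Schubert polynomials: `S w₀ = x^δ` and
`S w - s_i·(S w) = (x_i - x_{i+1}) · S (w s_i)` whenever `ℓ(w s_i) < ℓ(w)`. -/
def IsSchubertFamily (n : ℕ) (S : Perm' n → MvPolynomial (Fin n) ℤ) : Prop :=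
  S (w0 n) = xDelta n ∧
  ∀ (w : Perm' n) (i : ℕ) (h : i + 1 < n),
    invLength (w * Equiv.swap (⟨i, by omega⟩ : Fin n) ⟨i + 1, h⟩) < invLength w →
    S w - rename (Equiv.swap (⟨i, by omega⟩ : Fin n) ⟨i + 1, h⟩) (S w) =
      (X (⟨i, by omega⟩ : Fin n) - X ⟨i + 1, h⟩) *
        S (w * Equiv.swap (⟨i, by omega⟩ : Fin n) ⟨i + 1, h⟩)

/-- The ideal generated by the elementary symmetric polynomials `e₁, …, e_n`. -/
def symIdeal (n : ℕ) : Ideal (MvPolynomial (Fin n) ℤ) :=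
  Ideal.span ((fun k => esymm (Fin n) ℤ k) '' Set.Icc 1 n)

/-- `g` is the normal form of `f` modulo the ideal of elementary symmetric polynomials :
`f ≡ g` and every monomial of `g` divides `x^δ`.  (For the degree reverse lexicographic
term order with `x₁ < ⋯ < x_n`, the normal form is exactly the unique such `g`.) -/
def IsNormalForm (n : ℕ) (f g : MvPolynomial (Fin n) ℤ) : Prop :=
  f - g ∈ symIdeal n ∧ ∀ d ∈ g.support, ∀ i : Fin n, d i ≤ n - 1 - (i : ℕ)

def finSubEquiv {n N : ℕ} (h : n ≤ N) : Fin n ≃ {i : Fin N // (i : ℕ) < n} where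
  toFun i := ⟨Fin.castLE h i, i.isLt⟩
  invFun j := ⟨(j.1 : ℕ), j.2⟩
  left_inv i := rfl
  right_inv j := rfl

/-- The standard inclusion `Σ_n ⊂ Σ_N`, extending a permutation by fixed points. -/
def permIncl {n N : ℕ} (h : n ≤ N) (u : Perm' n) : Perm' N :=
  u.extendDomain (finSubEquiv h)

/-- `δ` as an exponent vector. -/
def deltaF (n : ℕ) : Fin n →₀ ℕ :=
  Finsupp.equivFunOnFinite.symm fun i => n - 1 - (i : ℕ)

/-- The type of a chain as an exponent vector. -/
def chainTypeF {n m : ℕ} {u w : Perm' n} (γ : LabeledChain n m u w) : Fin n →₀ ℕ :=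
  Finsupp.equivFunOnFinite.symm (chainType γ)

/-- `δ` as an integral exponent vector. -/
def deltaZ (n : ℕ) : Fin n →₀ ℤ :=
  Finsupp.equivFunOnFinite.symm fun i => ((n - 1 - (i : ℕ) : ℕ) : ℤ)

/-- The type of a chain as an integral exponent vector. -/
def chainTypeZ {n m : ℕ} {u w : Perm' n} (γ : LabeledChain n m u w) : Fin n →₀ ℤ :=
  Finsupp.equivFunOnFinite.symm fun k => ((chainType γ k : ℕ) : ℤ)

/-- The inclusion of polynomials into Laurent polynomials. -/
def toLaurent (n : ℕ) : MvPolynomial (Fin n) ℤ →+* AddMonoidAlgebra ℤ (Fin n →₀ ℤ) :=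
  AddMonoidAlgebra.mapDomainRingHom ℤ (Finsupp.mapRange.addMonoidHom (Nat.castAddMonoidHom ℤ))

/-- The complete homogeneous symmetric polynomial `h_a(x₁, …, x_k)` inside
`ℤ[x₁, …, x_n]` (variables are 0-indexed, so the first `k` variables are used). -/
def hpoly (n k a : ℕ) : MvPolynomial (Fin n) ℤ :=
  ∑ s ∈ (Finset.univ.filter (fun i : Fin n => (i : ℕ) < k)).sym a,
    ((s : Multiset (Fin n)).map X).prod

/-- `h_α = h_{α₁}(x₁) h_{α₂}(x₁,x₂) ⋯ h_{α_{n-1}}(x₁, …, x_{n-1})` (0-indexed `α`). -/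
def hAlpha (n : ℕ) (α : Fin n → ℕ) : MvPolynomial (Fin n) ℤ :=
  ∏ i : Fin n, hpoly n ((i : ℕ) + 1) (α i)

/- ## rc-graphs (0-indexed pairs: the paper's pair `(k,b)` is `(k-1, b-1)`) -/

/-- The linear order on rc-graph positions: `(k,b) ≤ (j,a)  ⇔  k < j, or k = j and b ≥ a`. -/
def rcLE (p q : ℕ × ℕ) : Prop := p.1 < q.1 ∨ (p.1 = q.1 ∧ q.2 ≤ p.2)

instance : DecidableRel rcLE := fun p q => by unfold rcLE; exact inferInstance
instance : IsTrans (ℕ × ℕ) rcLE :=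
  ⟨fun a b c h1 h2 => by unfold rcLE at h1 h2 ⊢; omega⟩
instance : IsAntisymm (ℕ × ℕ) rcLE :=
  ⟨fun a b h1 h2 => by unfold rcLE at h1 h2; rw [Prod.ext_iff]; omega⟩
instance : IsTotal (ℕ × ℕ) rcLE := ⟨fun a b => by unfold rcLE; omega⟩

/-- The adjacent transposition `s_{i+1} = (i, i+1)` (0-indexed positions). -/
def adjT (n : ℕ) (i : ℕ) : Perm' n :=
  if h : i + 1 < n then Equiv.swap ⟨i, by omega⟩ ⟨i + 1, h⟩ else 1

/-- The word `d(R)` of a set of positions: list its elements in the order `rcLE` and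
record `k + b` for each pair (0-indexed version of `k + b - 1`). -/
def rcWord (R : Finset (ℕ × ℕ)) : List ℕ :=
  (R.sort rcLE).map (fun p => p.1 + p.2)

/-- The permutation given by a word in the adjacent transpositions. -/
def wordPerm (n : ℕ) (l : List ℕ) : Perm' n :=
  (l.map (adjT n)).prod

/-- The permutation of a set of rc-positions. -/
def rcPerm (n : ℕ) (R : Finset (ℕ × ℕ)) : Perm' n := wordPerm n (rcWord R)

/-- `R` consists of valid rc-positions: (0-indexed) `k + b + 2 ≤ n`. -/
def IsRC (n : ℕ) (R : Finset (ℕ × ℕ)) : Prop := ∀ p ∈ R, p.1 + p.2 + 2 ≤ n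

/-- `R ∈ 𝓡(w)`: `R` is an rc-graph associated to `w`, i.e. `d(R)` is a reduced word for `w`. -/
def AssocRC (n : ℕ) (R : Finset (ℕ × ℕ)) (w : Perm' n) : Prop :=
  IsRC n R ∧ rcPerm n R = w ∧ R.card = invLength w

/-- All valid rc-positions for `Σ_n`. -/
def fullRC (n : ℕ) : Finset (ℕ × ℕ) :=
  (Finset.range n ×ˢ Finset.range n).filter (fun p => p.1 + p.2 + 2 ≤ n)

/-- One greedy step: adjoin the lexicographically smallest valid pair not in `R`. -/
def GreedyStep (n : ℕ) (R R' : Finset (ℕ × ℕ)) : Prop :=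
  ∃ p : ℕ × ℕ, p ∉ R ∧ p.1 + p.2 + 2 ≤ n ∧
    (∀ q : ℕ × ℕ, q.1 + q.2 + 2 ≤ n → q ∉ R → (p.1 < q.1 ∨ (p.1 = q.1 ∧ p.2 ≤ q.2))) ∧
    R' = insert p R

/-- The exponent of `x_i` in `x^R`. -/
def rcType (n : ℕ) (R : Finset (ℕ × ℕ)) : Fin n → ℕ :=
  fun i => (R.filter (fun p => p.1 = (i : ℕ))).card

/-- `γ = γ(R)`: the chain `γ` is produced from `R` by the greedy sequence. -/
def GreedyRel (n : ℕ) {m : ℕ} (w : Perm' n) (R : Finset (ℕ × ℕ))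
    (γ : LabeledChain n m w (w0 n)) : Prop :=
  ∃ Rs : ℕ → Finset (ℕ × ℕ), Rs 0 = R ∧
    (∀ i < m, GreedyStep n (Rs i) (Rs (i + 1))) ∧
    (∀ i : Fin m, γ.lab i ∉ Rs (i : ℕ) ∧ Rs ((i : ℕ) + 1) = insert (γ.lab i) (Rs (i : ℕ))) ∧
    (∀ i : Fin (m + 1), rcPerm n (Rs (i : ℕ)) = γ.c i)

namespace SchubertChains

/-- One-line notation of `w` as a function on all of `ℕ`, fixing every `j ≥ n`. -/
def oneLine {n : ℕ} (w : Perm' n) (j : ℕ) : ℕ := if h : j < n then (w ⟨j, h⟩ : ℕ) else j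

lemma oneLine_of_lt {n : ℕ} (w : Perm' n) {j : ℕ} (h : j < n) : oneLine w j = w ⟨j, h⟩ := by
  simp [oneLine, h]

lemma oneLine_coe {n : ℕ} (w : Perm' n) (j : Fin n) : oneLine w j = w j := by
  simp [oneLine]

lemma oneLine_lt {n : ℕ} (w : Perm' n) {j : ℕ} (h : j < n) : oneLine w j < n := by
  simp [oneLine, h]

lemma oneLine_injective {n : ℕ} (w : Perm' n) : Function.Injective (oneLine w) := by
  intro a b hab
  by_cases ha : a < n <;> by_cases hb : b < n
  · rw [oneLine_of_lt w ha, oneLine_of_lt w hb] at hab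
    simpa using w.injective (Fin.ext hab)
  · have := oneLine_lt w ha
    simp only [oneLine, hb, dite_false] at hab this
    omega
  · have := oneLine_lt w hb
    simp only [oneLine, ha, dite_false] at hab this
    omega
  · simpa [oneLine, ha, hb] using hab

lemma perm_ext {n : ℕ} {u w : Perm' n} (h : ∀ j < n, oneLine u j = oneLine w j) : u = w := by
  ext j
  simpa [oneLine_coe] using h j j.2

lemma adjT_of_lt {n i : ℕ} (h : i + 1 < n) :
    adjT n i = Equiv.swap ⟨i, by omega⟩ ⟨i + 1, h⟩ := by
  simp [adjT, h]

lemma adjT_mul_self (n i : ℕ) : adjT n i * adjT n i = 1 := by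
  unfold adjT
  split_ifs <;> simp

lemma oneLine_mul_swap {n : ℕ} (w : Perm' n) (a c : Fin n) (j : ℕ) :
    oneLine (w * Equiv.swap a c) j =
      oneLine w (if j = a then c else if j = c then a else j) := by
  by_cases hj : j < n
  · rw [oneLine_of_lt _ hj, Equiv.Perm.mul_apply, ← oneLine_coe]
    congr 1
    rw [Equiv.swap_apply_def]
    simp only [Fin.ext_iff]
    split_ifs <;> rfl
  · have h1 : j ≠ a := by omega
    have h2 : j ≠ c := by omega
    simp [oneLine, hj, h1, h2]

lemma oneLine_mul_adjT {n i : ℕ} (w : Perm' n) (h : i + 1 < n) (j : ℕ) :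
    oneLine (w * adjT n i) j =
      oneLine w (if j = i then i + 1 else if j = i + 1 then i else j) := by
  rw [adjT_of_lt h, oneLine_mul_swap]

/-- `w` has a descent at position `i`. -/
def HasDescent {n : ℕ} (w : Perm' n) (i : ℕ) : Prop :=
  i + 1 < n ∧ oneLine w (i + 1) < oneLine w i

lemma hasDescent_mul_adjT {n i j : ℕ} (w : Perm' n) (h : i + 1 < n) :
    HasDescent (w * adjT n i) j ↔ j + 1 < n ∧
      oneLine w (if j + 1 = i then i + 1 else if j + 1 = i + 1 then i else j + 1) <
        oneLine w (if j = i then i + 1 else if j = i + 1 then i else j) := by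
  simp only [HasDescent, oneLine_mul_adjT w h]

lemma adjT_comm {n i j : ℕ} (hij : i + 1 < j) : adjT n i * adjT n j = adjT n j * adjT n i := by
  by_cases hj : j + 1 < n
  · apply perm_ext
    intro m _
    rw [oneLine_mul_adjT _ hj, oneLine_mul_adjT _ (by omega), ← one_mul (adjT n i),
      ← one_mul (adjT n j), oneLine_mul_adjT _ (by omega), oneLine_mul_adjT _ hj]
    congr 1
    split_ifs <;> omega
  · simp [adjT, hj]

lemma adjT_braid {n i : ℕ} (h : i + 2 < n) :
    adjT n i * adjT n (i + 1) * adjT n i = adjT n (i + 1) * adjT n i * adjT n (i + 1) := by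
  apply perm_ext
  intro m _
  rw [← one_mul (adjT n i * _ * _), ← one_mul (adjT n (i + 1) * _ * _)]
  simp only [← mul_assoc, oneLine_mul_adjT _ (show i + 1 < n by omega), oneLine_mul_adjT _ h]
  congr 1
  split_ifs <;> omega

section NilCoxeter

variable {n : ℕ} {R : Type*} [CommRing R]

open Classical in
/-- Right multiplication by the `i`-th nilCoxeter generator, acting on coefficient functions. -/
def nilGen (n : ℕ) (R : Type*) [CommRing R] (i : ℕ) : Module.End R (Perm' n → R) where
  toFun f w := if HasDescent w i then f (w * adjT n i) else 0
  map_add' f g := by ext w; by_cases h : HasDescent w i <;> simp [h]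
  map_smul' a f := by ext w; by_cases h : HasDescent w i <;> simp [h]

open Classical in
lemma nilGen_apply (i : ℕ) (f : Perm' n → R) (w : Perm' n) :
    nilGen n R i f w = if HasDescent w i then f (w * adjT n i) else 0 := rfl

lemma nilGen_mul_self (i : ℕ) : nilGen n R i * nilGen n R i = 0 := by
  refine LinearMap.ext fun f => funext fun w => ?_
  simp only [Module.End.mul_apply, nilGen_apply, LinearMap.zero_apply, Pi.zero_apply]
  by_cases h : HasDescent w i
  · have : ¬ HasDescent (w * adjT n i) i := by
      rw [hasDescent_mul_adjT w h.1]
      have := h.2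
      simp
      omega
    simp [this]
  · simp [h]

lemma nilGen_commute {i j : ℕ} (hij : i + 1 < j) : Commute (nilGen n R i) (nilGen n R j) := by
  refine LinearMap.ext fun f => funext fun w => ?_
  simp only [Module.End.mul_apply, nilGen_apply]
  by_cases hj : j + 1 < n
  · have hi : i + 1 < n := by omega
    have h1 : HasDescent (w * adjT n i) j ↔ HasDescent w j := by
      rw [hasDescent_mul_adjT w hi, if_neg (by omega), if_neg (by omega), if_neg (by omega),
        if_neg (by omega), HasDescent]
    have h2 : HasDescent (w * adjT n j) i ↔ HasDescent w i := by
      rw [hasDescent_mul_adjT w hj, if_neg (by omega), if_neg (by omega), if_neg (by omega),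
        if_neg (by omega), HasDescent]
    by_cases hdi : HasDescent w i <;> by_cases hdj : HasDescent w j <;>
      simp [h1, h2, hdi, hdj, mul_assoc, adjT_comm hij]
  · simp [HasDescent, hj]

lemma nilGen_braid (i : ℕ) :
    nilGen n R i * nilGen n R (i + 1) * nilGen n R i =
      nilGen n R (i + 1) * nilGen n R i * nilGen n R (i + 1) := by
  refine LinearMap.ext fun f => funext fun w => ?_
  simp only [Module.End.mul_apply, nilGen_apply]
  by_cases h : i + 2 < n
  · have hi : i + 1 < n := by omega
    have hL : (HasDescent w i ∧ HasDescent (w * adjT n i) (i + 1) ∧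
        HasDescent (w * adjT n i * adjT n (i + 1)) i) ↔
        (oneLine w (i + 1 + 1) < oneLine w (i + 1) ∧ oneLine w (i + 1) < oneLine w i) := by
      simp only [HasDescent, oneLine_mul_adjT _ hi, oneLine_mul_adjT _ h]
      simp [show ¬ i = i + 1 + 1 by omega, show ¬ i + 1 + 1 = i by omega]
      omega
    have hR : (HasDescent w (i + 1) ∧ HasDescent (w * adjT n (i + 1)) i ∧
        HasDescent (w * adjT n (i + 1) * adjT n i) (i + 1)) ↔
        (oneLine w (i + 1 + 1) < oneLine w (i + 1) ∧ oneLine w (i + 1) < oneLine w i) := by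
      simp only [HasDescent, oneLine_mul_adjT _ hi, oneLine_mul_adjT _ h]
      simp [show ¬ i = i + 1 + 1 by omega, show ¬ i + 1 + 1 = i by omega]
      omega
    simp only [← ite_and]
    simp only [hL, hR]
    have := adjT_braid h
    simp only [mul_assoc] at this ⊢
    rw [this]
  · have h1 : ∀ v : Perm' n, ¬ HasDescent v (i + 1) := fun v hv => h hv.1
    simp [h1]

lemma one_sub_mul_one_add_nilGen (x : R) (i : ℕ) :
    (1 - x • nilGen n R i) * (1 + x • nilGen n R i) = 1 := by
  simp [sub_mul, mul_add, nilGen_mul_self]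

/-- The product `(1 + x u_i) (1 + x u_{i+1}) ⋯ (1 + x u_{i+m-1})` of operators. -/
def nilProd (n : ℕ) {R : Type*} [CommRing R] (x : R) : ℕ → ℕ → Module.End R (Perm' n → R)
  | 0, _ => 1
  | m + 1, i => (1 + x • nilGen n R i) * nilProd n x m (i + 1)

lemma commute_nilGen_nilProd (x : R) {i : ℕ} (m : ℕ) :
    ∀ j, i + 1 < j → Commute (nilGen n R i) (nilProd n x m j) := by
  induction m with
  | zero => intro j _; exact Commute.one_right _
  | succ m ih =>
    intro j hj
    exact ((Commute.one_right _).add_right ((nilGen_commute hj).smul_right x)).mul_right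
      (ih (j + 1) (by omega))

lemma nilProd_eq (x : R) (m i : ℕ) :
    nilProd n x m (i + 1) = (1 - x • nilGen n R i) * nilProd n x (m + 1) i := by
  rw [nilProd, ← mul_assoc, one_sub_mul_one_add_nilGen, one_mul]

/-- The conjugated product appearing in the exchange of two rows is symmetric in `x` and `y`. -/
lemma nilGen_exchange (x y : R) (i : ℕ) :
    (1 + x • nilGen n R i) * (1 + x • nilGen n R (i + 1)) * (1 + y • nilGen n R i) *
        (1 - x • nilGen n R (i + 1)) =
      1 + (x + y) • nilGen n R i +
        (x * y) • (nilGen n R (i + 1) * nilGen n R i - nilGen n R i * nilGen n R (i + 1)) := by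
  have ha := nilGen_mul_self (n := n) (R := R) i
  have hb := nilGen_mul_self (n := n) (R := R) (i + 1)
  have hab := nilGen_braid (n := n) (R := R) i
  generalize nilGen n R i = a at *
  generalize nilGen n R (i + 1) = b at *
  have h1 : a * (b * (a * b)) = 0 := by
    rw [← mul_assoc, ← mul_assoc, hab, mul_assoc, hb, mul_zero]
  have ha' : ∀ z, a * (a * z) = 0 := fun z => by rw [← mul_assoc, ha, zero_mul]
  rw [mul_assoc, mul_assoc] at hab
  simp only [mul_add, add_mul, mul_sub, mul_one, one_mul, smul_mul_assoc, mul_smul_comm,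
    mul_assoc, hb, ha, h1, smul_zero, mul_zero, add_zero]
  rw [hab]
  module

lemma commute_nilProd (x y : R) (m : ℕ) :
    ∀ i, Commute (nilProd n x m i) (nilProd n y m i) := by
  induction m with
  | zero => intro i; exact Commute.one_left _
  | succ m ih =>
    intro i
    cases m with
    | zero =>
      simp only [nilProd, mul_one]
      exact ((Commute.one_right _).add_right
        (((Commute.one_left _).add_left ((Commute.refl _).smul_left x)).smul_right y))
    | succ m =>
      have key : ∀ x y : R, nilProd n x (m + 2) i * nilProd n y (m + 2) i =
          (1 + (x + y) • nilGen n R i + (x * y) •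
            (nilGen n R (i + 1) * nilGen n R i - nilGen n R i * nilGen n R (i + 1))) *
            (nilProd n x (m + 1) (i + 1) * nilProd n y (m + 1) (i + 1)) := by
        intro x y
        have hc : nilProd n x m (i + 2) * (1 + y • nilGen n R i) =
            (1 + y • nilGen n R i) * nilProd n x m (i + 2) :=
          ((Commute.one_right _).add_right
            ((commute_nilGen_nilProd x m (i + 2) (by omega)).symm.smul_right y)).eq
        calc nilProd n x (m + 2) i * nilProd n y (m + 2) i
            = (1 + x • nilGen n R i) * (1 + x • nilGen n R (i + 1)) *
                (nilProd n x m (i + 2) * (1 + y • nilGen n R i)) *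
                nilProd n y (m + 1) (i + 1) := by
              simp only [nilProd, mul_assoc]
          _ = (1 + x • nilGen n R i) * (1 + x • nilGen n R (i + 1)) * (1 + y • nilGen n R i) *
                nilProd n x m (i + 1 + 1) * nilProd n y (m + 1) (i + 1) := by
              rw [hc]; simp only [mul_assoc]
          _ = _ := by
              rw [nilProd_eq x m (i + 1), ← nilGen_exchange]
              simp only [mul_assoc]
      have := ih (i + 1)
      rw [commute_iff_eq, key, key, this.eq, add_comm x y, mul_comm x y]

/-- The product of the rows `k, …, k + r - 1`, later rows being applied last. -/
def rowProd (n : ℕ) {R : Type*} [CommRing R] (x : ℕ → R) : ℕ → ℕ → Module.End R (Perm' n → R)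
  | 0, _ => 1
  | r + 1, k => rowProd n x r (k + 1) * nilProd n (x k) (n - 1 - k) k

lemma commute_nilGen_rowProd (x : ℕ → R) {i : ℕ} (r : ℕ) :
    ∀ k, i + 1 < k → Commute (nilGen n R i) (rowProd n x r k) := by
  induction r with
  | zero => intro k _; exact Commute.one_right _
  | succ r ih =>
    intro k hk
    exact (ih (k + 1) (by omega)).mul_right (commute_nilGen_nilProd _ _ _ hk)

lemma rowProd_congr {x y : ℕ → R} (r : ℕ) :
    ∀ k, (∀ j, k ≤ j → x j = y j) → rowProd n x r k = rowProd n y r k := by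
  induction r with
  | zero => intro k _; rfl
  | succ r ih =>
    intro k h
    rw [rowProd, rowProd, ih (k + 1) (fun j hj => h j (by omega)), h k le_rfl]

lemma nilProd_sub_swap (x y : R) (m i : ℕ) :
    nilProd n y m (i + 1) * nilProd n x (m + 1) i - nilProd n x m (i + 1) * nilProd n y (m + 1) i =
      (x - y) • (nilGen n R i * (nilProd n y m (i + 1) * nilProd n x (m + 1) i)) := by
  have h1 : nilGen n R i * nilProd n y m (i + 1) = nilGen n R i * nilProd n y (m + 1) i := by
    rw [nilProd, ← mul_assoc, mul_add, mul_one, mul_smul_comm, nilGen_mul_self, smul_zero,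
      add_zero]
  rw [← mul_assoc (nilGen n R i), h1, nilProd_eq y, nilProd_eq x, mul_assoc, mul_assoc,
    (commute_nilProd x y (m + 1) i).eq, mul_assoc]
  simp only [sub_mul, one_mul, smul_mul_assoc]
  module

/-- The divided difference of the product of all rows is left multiplication by a generator. -/
lemma rowProd_sub_swap (x : ℕ → R) {i : ℕ} (hi : i + 1 < n) (r : ℕ) :
    ∀ k, k ≤ i → i + 1 < k + r →
      rowProd n x r k - rowProd n (x ∘ Equiv.swap i (i + 1)) r k =
        (x i - x (i + 1)) • (nilGen n R i * rowProd n x r k) := by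
  induction r with
  | zero => intro k _ _; omega
  | succ r ih =>
    intro k hk hr
    rcases hk.lt_or_eq with hk | rfl
    · have hx : (x ∘ Equiv.swap i (i + 1)) k = x k := by
        simp [Equiv.swap_apply_of_ne_of_ne (show k ≠ i by omega) (show k ≠ i + 1 by omega)]
      rw [rowProd, rowProd, hx, ← sub_mul, ih (k + 1) hk (by omega), smul_mul_assoc, mul_assoc]
    · obtain ⟨r, rfl⟩ : ∃ s, r = s + 1 := ⟨r - 1, by omega⟩
      obtain ⟨m, hm⟩ : ∃ m, n - 1 - k = m + 1 := ⟨n - 2 - k, by omega⟩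
      have hm' : n - 1 - (k + 1) = m := by omega
      have hc : rowProd n (x ∘ Equiv.swap k (k + 1)) r (k + 1 + 1) =
          rowProd n x r (k + 1 + 1) := rowProd_congr r _ fun j hj => by
        simp [Equiv.swap_apply_of_ne_of_ne (show j ≠ k by omega) (show j ≠ k + 1 by omega)]
      have hcomm := commute_nilGen_rowProd (n := n) x r (k + 2) (show k + 1 < k + 2 by omega)
      simp only [rowProd, hc, hm, hm', Function.comp_apply, Equiv.swap_apply_left,
        Equiv.swap_apply_right]
      rw [mul_assoc, mul_assoc, ← mul_sub, nilProd_sub_swap, mul_smul_comm, ← mul_assoc,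
        ← hcomm.eq, mul_assoc]

lemma map_nilGen {R' : Type*} [CommRing R'] (φ : R →+* R') (i : ℕ) (f : Perm' n → R) :
    φ ∘ nilGen n R i f = nilGen n R' i (φ ∘ f) := by
  ext w
  simp only [Function.comp_apply, nilGen_apply]
  split_ifs <;> simp

lemma map_nilProd {R' : Type*} [CommRing R'] (φ : R →+* R') (x : R) (m : ℕ) (f : Perm' n → R) :
    ∀ i, φ ∘ nilProd n x m i f = nilProd n (φ x) m i (φ ∘ f) := by
  induction m with
  | zero => intro i; rfl
  | succ m ih =>
    intro i
    simp only [nilProd, Module.End.mul_apply, LinearMap.add_apply, Module.End.one_apply,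
      LinearMap.smul_apply, ← ih, ← map_nilGen]
    ext w
    simp

lemma map_rowProd {R' : Type*} [CommRing R'] (φ : R →+* R') (x : ℕ → R) (r : ℕ) :
    ∀ k (f : Perm' n → R), φ ∘ rowProd n x r k f = rowProd n (φ ∘ x) r k (φ ∘ f) := by
  induction r with
  | zero => intro k f; rfl
  | succ r ih =>
    intro k f
    simp only [rowProd, Module.End.mul_apply, ih, map_nilProd, Function.comp_apply]

/-- Labeled covers in terms of one-line notation on natural numbers. -/
lemma isLabeledCover_iff {u u' : Perm' n} {k b : ℕ} :
    IsLabeledCover u u' k b ↔ ∃ a c : ℕ, a ≤ k ∧ k < c ∧ c < n ∧ oneLine u a < oneLine u c ∧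
      (∀ m, a < m → m < c → ¬ (oneLine u a < oneLine u m ∧ oneLine u m < oneLine u c)) ∧
      b = oneLine u a ∧
      ∀ j, oneLine u' j = oneLine u (if j = a then c else if j = c then a else j) := by
  constructor
  · rintro ⟨a, c, _, h2, h3, rfl, h5, h6, h7⟩
    refine ⟨a, c, h5, h6, c.2, ?_, ?_, ?_, fun j => oneLine_mul_swap _ _ _ _⟩
    · rw [oneLine_coe, oneLine_coe]
      exact h2
    · intro m hm hm'
      rw [oneLine_coe, oneLine_coe, oneLine_of_lt u (show m < n by omega)]
      exact h3 ⟨m, by omega⟩ hm hm'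
    · rw [oneLine_coe, h7]
  · rintro ⟨a, c, h1, h2, h3, h4, h5, h6, h7⟩
    have ha : a < n := by omega
    rw [oneLine_of_lt u ha, oneLine_of_lt u h3] at h4
    refine ⟨⟨a, ha⟩, ⟨c, h3⟩, h1.trans_lt h2, h4, ?_, ?_, h1, h2, ?_⟩
    · intro m hm hm'
      have := h5 m hm hm'
      rwa [oneLine_coe, oneLine_of_lt u ha, oneLine_of_lt u h3] at this
    · apply perm_ext
      intro j _
      rw [h7, oneLine_mul_swap]
    · rw [h6, oneLine_of_lt u ha]

lemma isLabeledCover_mul_adjT {u u' : Perm' n} {k b i a c : ℕ} (hi : i + 1 < n) (hik : i ≠ k)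
    (h1 : a ≤ k) (h2 : k < c) (h3 : c < n) (h4 : oneLine u a < oneLine u c)
    (h5 : ∀ m, a < m → m < c → ¬ (oneLine u a < oneLine u m ∧ oneLine u m < oneLine u c))
    (h6 : b = oneLine u a)
    (h7 : ∀ j, oneLine u' j = oneLine u (if j = a then c else if j = c then a else j))
    (h8 : a = i + 1 → ¬ (oneLine u a < oneLine u i ∧ oneLine u i < oneLine u c))
    (h9 : c = i → ¬ (oneLine u a < oneLine u (i + 1) ∧ oneLine u (i + 1) < oneLine u c)) :
    IsLabeledCover (u * adjT n i) (u' * adjT n i) k b := by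
  rw [isLabeledCover_iff]
  simp only [oneLine_mul_adjT _ hi, h7]
  have hs : ∀ j : ℕ, (if (if j = i then i + 1 else if j = i + 1 then i else j) = i then i + 1
      else if (if j = i then i + 1 else if j = i + 1 then i else j) = i + 1 then i
      else (if j = i then i + 1 else if j = i + 1 then i else j)) = j := by
    intro j
    split_ifs <;> omega
  refine ⟨if a = i then i + 1 else if a = i + 1 then i else a,
    if c = i then i + 1 else if c = i + 1 then i else c, ?_, ?_, ?_, ?_, ?_, ?_, ?_⟩
  · split_ifs <;> omega
  · split_ifs <;> omega
  · split_ifs <;> omega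
  · rwa [hs, hs]
  · intro m hm hm'
    rw [hs, hs]
    by_cases hmi : m = i
    · subst hmi
      rw [if_pos rfl]
      by_cases hc : c = m
      · exact h9 hc
      · exact h5 _ (by split_ifs at hm <;> omega) (by split_ifs at hm' <;> omega)
    by_cases hmi' : m = i + 1
    · subst hmi'
      rw [if_neg (by omega), if_pos rfl]
      by_cases ha : a = i + 1
      · exact h8 ha
      · exact h5 _ (by split_ifs at hm <;> omega) (by split_ifs at hm' <;> omega)
    rw [if_neg hmi, if_neg hmi']
    exact h5 _ (by split_ifs at hm <;> omega) (by split_ifs at hm' <;> omega)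
  · rw [hs, h6]
  · intro j
    let s : ℕ → ℕ := fun j => if j = i then i + 1 else if j = i + 1 then i else j
    have hs' : ∀ j, s (s j) = j := hs
    change oneLine u (if s j = a then c else if s j = c then a else s j) =
      oneLine u (s (if j = s a then s c else if j = s c then s a else j))
    by_cases ea : s j = a
    · rw [if_pos ea, if_pos (by rw [← ea, hs']), hs']
    by_cases ec : s j = c
    · rw [if_neg ea, if_pos ec, if_neg (fun h => ea (by rw [h, hs'])),
        if_pos (by rw [← ec, hs']), hs']
    · rw [if_neg ea, if_neg ec, if_neg (fun h => ea (by rw [h, hs'])),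
        if_neg (fun h => ec (by rw [h, hs']))]

lemma IsLabeledCover.mul_adjT {u u' : Perm' n} {k b i : ℕ} (hik : i ≠ k)
    (h : IsLabeledCover u u' k b) (hd : HasDescent u' i) :
    HasDescent u i ∧ IsLabeledCover (u * adjT n i) (u' * adjT n i) k b := by
  obtain ⟨hi, hd⟩ := hd
  obtain ⟨a, c, h1, h2, h3, h4, h5, h6, h7⟩ := isLabeledCover_iff.1 h
  rw [h7, h7] at hd
  have hne : oneLine u i ≠ oneLine u (i + 1) := fun h => by
    have := oneLine_injective u h
    omega
  refine ⟨⟨hi, ?_⟩, isLabeledCover_mul_adjT hi hik h1 h2 h3 h4 h5 h6 h7 ?_ ?_⟩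
  · have e1 := h5 i
    have e2 := h5 (i + 1)
    by_cases ha : i = a
    · subst ha
      rw [if_neg (by omega), if_neg (by omega), if_pos rfl] at hd
      have := e2 (by omega) (by omega)
      omega
    by_cases hc : i = c
    · subst hc
      rw [if_neg (by omega), if_neg (by omega), if_neg (by omega), if_pos rfl] at hd
      omega
    rw [if_neg ha, if_neg hc] at hd
    by_cases ha' : i + 1 = a
    · subst ha'
      rw [if_pos rfl] at hd
      omega
    rw [if_neg ha'] at hd
    by_cases hc' : i + 1 = c
    · subst hc'
      rw [if_pos rfl] at hd
      have := e1 (by omega) (by omega)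
      omega
    rwa [if_neg hc'] at hd
  · rintro rfl
    rw [if_pos rfl, if_neg (by omega), if_neg (by omega)] at hd
    omega
  · rintro rfl
    rw [if_neg (by omega), if_neg (by omega), if_neg (by omega), if_pos rfl] at hd
    omega

lemma IsLabeledCover.of_mul_adjT {u u' : Perm' n} {k b i : ℕ} (hik : i ≠ k)
    (hd : HasDescent u i) (h : IsLabeledCover (u * adjT n i) (u' * adjT n i) k b) :
    HasDescent u' i ∧ IsLabeledCover u u' k b := by
  obtain ⟨hi, hd⟩ := hd
  have hu : ∀ v : Perm' n, v * adjT n i * adjT n i = v := fun v => by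
    rw [mul_assoc, adjT_mul_self, mul_one]
  generalize hU : u * adjT n i = U at h
  generalize hU' : u' * adjT n i = U' at h
  obtain rfl : U * adjT n i = u := by rw [← hU, hu]
  obtain rfl : U' * adjT n i = u' := by rw [← hU', hu]
  obtain ⟨a, c, h1, h2, h3, h4, h5, h6, h7⟩ := isLabeledCover_iff.1 h
  rw [oneLine_mul_adjT _ hi, oneLine_mul_adjT _ hi, if_neg (by omega), if_pos rfl,
    if_pos rfl] at hd
  refine ⟨⟨hi, ?_⟩, isLabeledCover_mul_adjT hi hik h1 h2 h3 h4 h5 h6 h7 ?_ ?_⟩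
  · rw [oneLine_mul_adjT _ hi, oneLine_mul_adjT _ hi, if_neg (by omega), if_pos rfl, if_pos rfl,
      h7, h7]
    have e1 := h5 i
    have e2 := h5 (i + 1)
    by_cases ha : i = a
    · subst ha
      rw [if_pos rfl, if_neg (by omega), if_neg (by omega)]
      have := e2 (by omega) (by omega)
      have : oneLine U (i + 1) ≠ oneLine U c := fun h => by
        have := oneLine_injective U h
        omega
      omega
    by_cases hc : i = c
    · subst hc
      rw [if_neg (by omega), if_pos rfl, if_neg (by omega), if_neg (by omega)]
      omega
    rw [if_neg ha, if_neg hc]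
    by_cases ha' : i + 1 = a
    · subst ha'
      rw [if_pos rfl]
      omega
    rw [if_neg ha']
    by_cases hc' : i + 1 = c
    · subst hc'
      rw [if_pos rfl]
      have := e1 (by omega) (by omega)
      have : oneLine U i ≠ oneLine U a := fun h => ha (oneLine_injective U h)
      omega
    rwa [if_neg hc']
  · rintro rfl
    omega
  · rintro rfl
    omega

open Classical in
/-- The operator summing a coefficient function over all covers with label `(k, b)`. -/
def coverOp (n : ℕ) (R : Type*) [CommRing R] (k b : ℕ) : Module.End R (Perm' n → R) where
  toFun f u := ∑ u', if IsLabeledCover u u' k b then f u' else 0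
  map_add' f g := by
    ext u
    simp only [Pi.add_apply, ← Finset.sum_add_distrib]
    exact Finset.sum_congr rfl fun u' _ => by split_ifs <;> simp
  map_smul' a f := by
    ext u
    simp [Finset.mul_sum]

open Classical in
lemma coverOp_apply (k b : ℕ) (f : Perm' n → R) (u : Perm' n) :
    coverOp n R k b f u = ∑ u', if IsLabeledCover u u' k b then f u' else 0 := rfl

lemma commute_coverOp_nilGen {k b i : ℕ} (hik : i ≠ k) :
    Commute (coverOp n R k b) (nilGen n R i) := by
  classical
  refine LinearMap.ext fun f => funext fun u => ?_
  simp only [Module.End.mul_apply, nilGen_apply, coverOp_apply]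
  rw [← Equiv.sum_comp (Equiv.mulRight (adjT n i))
    (fun u' => if IsLabeledCover (u * adjT n i) u' k b then f u' else 0)]
  simp only [Equiv.coe_mulRight, ← ite_and]
  have key : ∀ u', (IsLabeledCover u u' k b ∧ HasDescent u' i) ↔
      (HasDescent u i ∧ IsLabeledCover (u * adjT n i) (u' * adjT n i) k b) := fun u' =>
    ⟨fun h => IsLabeledCover.mul_adjT hik h.1 h.2, fun h => (IsLabeledCover.of_mul_adjT hik h.1 h.2).symm⟩
  simp only [key]
  by_cases hd : HasDescent u i
  · simp only [hd, true_and, if_true]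
    exact Finset.sum_congr rfl fun _ _ => by congr
  · simp [hd]

lemma commute_coverOp_nilProd {k b : ℕ} (x : R) (m : ℕ) :
    ∀ i, k < i → Commute (coverOp n R k b) (nilProd n x m i) := by
  induction m with
  | zero => intro i _; exact Commute.one_right _
  | succ m ih =>
    intro i hi
    exact ((Commute.one_right _).add_right
      ((commute_coverOp_nilGen (by omega)).smul_right x)).mul_right (ih (i + 1) (by omega))

lemma commute_coverOp_rowProd {k b : ℕ} (x : ℕ → R) (r : ℕ) :
    ∀ i, k < i → Commute (coverOp n R k b) (rowProd n x r i) := by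
  induction r with
  | zero => intro i _; exact Commute.one_right _
  | succ r ih =>
    intro i hi
    exact (ih (i + 1) (by omega)).mul_right (commute_coverOp_nilProd _ _ _ hi)

/-- The operator product `u_k u_{k+1} ⋯ u_{k+b-1}`. -/
def nilRun (n : ℕ) (R : Type*) [CommRing R] (k : ℕ) : ℕ → Module.End R (Perm' n → R)
  | 0 => 1
  | b + 1 => nilRun n R k b * nilGen n R (k + b)

/-- The cycle `s_k s_{k+1} ⋯ s_{k+b-1}`. -/
def runPerm (n k : ℕ) : ℕ → Perm' n
  | 0 => 1
  | b + 1 => runPerm n k b * adjT n (k + b)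

lemma oneLine_mul_runPerm (u : Perm' n) (k : ℕ) {b : ℕ} (h : k + b < n) :
    ∀ j, oneLine (u * runPerm n k b) j =
      oneLine u (if j = k + b then k else if k ≤ j ∧ j < k + b then j + 1 else j) := by
  induction b with
  | zero =>
    intro j
    simp only [runPerm, mul_one]
    grind
  | succ b ih =>
    intro j
    rw [runPerm, ← mul_assoc, oneLine_mul_adjT _ (by omega), ih (by omega)]
    congr 1
    split_ifs <;> omega

open Classical in
lemma nilRun_apply (k : ℕ) {b : ℕ} (h : k + b < n) : ∀ (f : Perm' n → R) (u : Perm' n),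
    nilRun n R k b f u = if ∀ m, k < m → m ≤ k + b → oneLine u m < oneLine u k then
      f (u * runPerm n k b) else 0 := by
  induction b with
  | zero =>
    intro f u
    have : ∀ m, k < m → m ≤ k + 0 → oneLine u m < oneLine u k := by intro m _ _; omega
    rw [if_pos this]
    simp [nilRun, runPerm]
  | succ b ih =>
    intro f u
    have hd : HasDescent (u * runPerm n k b) (k + b) ↔
        oneLine u (k + b + 1) < oneLine u k := by
      simp only [HasDescent, oneLine_mul_runPerm u k (show k + b < n by omega)]
      simp
      omega
    rw [nilRun, Module.End.mul_apply, ih (by omega), nilGen_apply, hd, runPerm, ← mul_assoc,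
      ← ite_and]
    congr 1
    apply propext
    constructor
    · rintro ⟨h1, h2⟩ m hm hm'
      rcases Nat.lt_or_ge m (k + b + 1) with h3 | h3
      · exact h1 m hm (by omega)
      · rwa [show m = k + b + 1 by omega]
    · intro h1
      exact ⟨fun m hm hm' => h1 m hm (by omega), h1 _ (by omega) (by omega)⟩

/-- The first `k` positions carry `n-1, n-2, …, n-k`, and the following positions below `t`
carry `0, 1, 2, …`. -/
def IsStair {n : ℕ} (k t : ℕ) (v : Perm' n) : Prop :=
  (∀ j < k, oneLine v j = n - 1 - j) ∧ ∀ j, k ≤ j → j < t → oneLine v j = j - k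

/-- Removing the box `(k, b)` from a filled initial row segment corresponds to applying all
covers with label `(k, b)`. -/
lemma coverOp_nilRun {k b : ℕ} (hkb : k + b + 1 < n) {h : Perm' n → R}
    (hh : ∀ v, h v ≠ 0 → IsStair k (k + b + 1) v) :
    coverOp n R k b (nilRun n R k (b + 1) h) = nilRun n R k b h := by
  classical
  ext u
  have hk : k < n := by omega
  rw [coverOp_apply, nilRun_apply k (show k + b < n by omega)]
  simp only [nilRun_apply k (show k + (b + 1) < n by omega), ← ite_and]
  set u₀ : Perm' n := u * Equiv.swap ⟨k, hk⟩ ⟨k + b + 1, hkb⟩ with hu₀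
  have hu₀v : ∀ j, oneLine u₀ j =
      oneLine u (if j = k then k + b + 1 else if j = k + b + 1 then k else j) :=
    fun j => oneLine_mul_swap _ _ _ _
  rw [Finset.sum_eq_single u₀]
  · have hcyc : u₀ * runPerm n k (b + 1) = u * runPerm n k b := by
      apply perm_ext
      intro j _
      rw [oneLine_mul_runPerm _ _ (by omega), oneLine_mul_runPerm _ _ (by omega), hu₀v]
      congr 1
      split_ifs <;> omega
    rw [hcyc]
    by_cases hz : h (u * runPerm n k b) = 0
    · simp [hz]
    obtain ⟨s1, s2⟩ := hh _ hz
    have t0 : oneLine u k = b := by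
      have := s2 (k + b) (by omega) (by omega)
      rw [oneLine_mul_runPerm _ _ (by omega)] at this
      simp at this
      omega
    have t1 : ∀ m, k < m → m ≤ k + b → oneLine u m < b := by
      intro m hm hm'
      have := s2 (m - 1) (by omega) (by omega)
      rw [oneLine_mul_runPerm _ _ (by omega), if_neg (by omega), if_pos (by omega),
        Nat.sub_add_cancel (by omega)] at this
      omega
    have t2 : b < oneLine u (k + b + 1) := by
      by_contra hlt
      have hinj := oneLine_injective (u * runPerm n k b)
      have e1 : oneLine (u * runPerm n k b) (k + b + 1) = oneLine u (k + b + 1) := by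
        rw [oneLine_mul_runPerm _ _ (by omega), if_neg (by omega), if_neg (by omega)]
      have e2 := s2 (k + oneLine u (k + b + 1)) (by omega) (by omega)
      have := hinj (e1.trans (show oneLine u (k + b + 1) =
        oneLine (u * runPerm n k b) (k + oneLine u (k + b + 1)) by rw [e2]; omega))
      omega
    rw [if_pos, if_pos]
    · intro m hm hm'
      rw [t0]
      exact t1 m hm hm'
    · constructor
      · rw [isLabeledCover_iff]
        refine ⟨k, k + b + 1, le_rfl, by omega, hkb, by omega, ?_, t0.symm, hu₀v⟩
        intro m hm hm'
        have := t1 m hm (by omega)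
        omega
      · intro m hm hm'
        rw [hu₀v, hu₀v, if_neg (by omega), if_pos rfl]
        split_ifs with he
        · omega
        · have := t1 m hm (by omega)
          omega
  · intro u' _ hne
    by_cases hz : h (u' * runPerm n k (b + 1)) = 0
    · simp [hz]
    rw [if_neg]
    rintro ⟨hc, hmax⟩
    apply hne
    obtain ⟨s1, s2⟩ := hh _ hz
    obtain ⟨a, c, h1, h2, h3, h4, h5, h6, h7⟩ := isLabeledCover_iff.1 hc
    have hb : oneLine u' (k + b + 1) = b := by
      have := s2 (k + b) (by omega) (by omega)
      rw [oneLine_mul_runPerm _ _ (by omega), if_neg (by omega), if_pos (by omega)] at this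
      omega
    have hc' : oneLine u' c = b := by
      rw [h7, if_neg (by omega), if_pos rfl, h6]
    obtain rfl : c = k + b + 1 := oneLine_injective u' (hc'.trans hb.symm)
    have hak : a = k := by
      by_contra hak
      have hp : ∀ j < k, oneLine u' j = n - 1 - j := by
        intro j hj
        have := s1 j hj
        rwa [oneLine_mul_runPerm _ _ (by omega), if_neg (by omega), if_neg (by omega)] at this
      have ha := hp a (by omega)
      have hkv : oneLine u' k = oneLine u k := by
        rw [h7, if_neg (by omega), if_neg (by omega)]
      have hav : oneLine u' a = oneLine u (k + b + 1) := by rw [h7, if_pos rfl]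
      have hgt := hmax (k + b + 1) (by omega) (by omega)
      have hlt : oneLine u' k < oneLine u' a := by
        by_contra hge
        have hkn := oneLine_lt u' hk
        have := hp (n - 1 - oneLine u' k) (by omega)
        have := oneLine_injective u' (this.trans (by omega : _ = oneLine u' k))
        omega
      exact h5 k (by omega) (by omega) ⟨by omega, by omega⟩
    subst hak
    apply perm_ext
    intro j _
    rw [h7, hu₀v]
  · simp

/-- The coefficient function obtained after filling the first `k` rows completely. -/
def fullRow (n : ℕ) (R : Type*) [CommRing R] : ℕ → Perm' n → R
  | 0 => Pi.single 1 1
  | k + 1 => nilRun n R k (n - 1 - k) (fullRow n R k)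

lemma isStair_succ_iff {k : ℕ} (hk : k < n) (u : Perm' n) :
    ((∀ m, k < m → m ≤ k + (n - 1 - k) → oneLine u m < oneLine u k) ∧
      IsStair k n (u * runPerm n k (n - 1 - k))) ↔ IsStair (k + 1) n u := by
  have hr := oneLine_mul_runPerm u k (show k + (n - 1 - k) < n by omega)
  constructor
  · rintro ⟨-, h1, h2⟩
    refine ⟨fun j hj => ?_, fun j hj hj' => ?_⟩
    · rcases Nat.lt_or_ge j k with hjk | hjk
      · have := h1 j hjk
        rwa [hr, if_neg (by omega), if_neg (by omega)] at this
      · obtain rfl : j = k := by omega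
        have := h2 (n - 1) (by omega) (by omega)
        rwa [hr, if_pos (by omega)] at this
    · have := h2 (j - 1) (by omega) (by omega)
      rw [hr, if_neg (by omega), if_pos (by omega), Nat.sub_add_cancel (by omega)] at this
      omega
  · rintro ⟨h1, h2⟩
    refine ⟨fun m hm hm' => ?_, fun j hj => ?_, fun j hj hj' => ?_⟩
    · have := h1 k (by omega)
      have := h2 m (by omega) (by omega)
      omega
    · rw [hr, if_neg (by omega), if_neg (by omega)]
      exact h1 j (by omega)
    · rw [hr]
      by_cases hjn : j = k + (n - 1 - k)
      · rw [if_pos hjn, h1 k (by omega)]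
        omega
      · rw [if_neg hjn, if_pos (by omega), h2 (j + 1) (by omega) (by omega)]
        omega

open Classical in
lemma fullRow_apply {k : ℕ} (hk : k ≤ n) (u : Perm' n) :
    fullRow n R k u = if IsStair k n u then 1 else 0 := by
  induction k generalizing u with
  | zero =>
    have : IsStair 0 n u ↔ u = 1 := by
      constructor
      · rintro ⟨-, h⟩
        apply perm_ext
        intro j hj
        rw [h j (by omega) hj, oneLine_of_lt _ hj]
        simp
      · rintro rfl
        refine ⟨fun j hj => by omega, fun j _ hj => ?_⟩
        rw [oneLine_of_lt _ hj]
        simp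
    simp only [this, fullRow, Pi.single_apply]
  | succ k ih =>
    rw [fullRow, nilRun_apply k (by omega), ih (by omega), ← ite_and]
    simp only [isStair_succ_iff hk]

lemma isStair_of_fullRow_ne_zero {k : ℕ} (hk : k ≤ n) {u : Perm' n} (h : fullRow n R k u ≠ 0) :
    IsStair k n u := by
  classical
  rw [fullRow_apply hk] at h
  exact of_not_not fun hn => h (if_neg hn)

lemma isStair_self_iff (u : Perm' n) : IsStair n n u ↔ u = w0 n := by
  have hw : ∀ j, j < n → oneLine (w0 n) j = n - 1 - j := fun j hj => by
    rw [oneLine_of_lt _ hj, w0, Fin.revPerm_apply, Fin.val_rev]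
    simp only
    omega
  constructor
  · rintro ⟨h, -⟩
    apply perm_ext
    intro j hj
    rw [h j hj, hw j hj]
  · rintro rfl
    exact ⟨hw, fun j hj hj' => by omega⟩

lemma fullRow_self : fullRow n R n = Pi.single (w0 n) 1 := by
  classical
  ext u
  rw [fullRow_apply le_rfl, Pi.single_apply]
  simp only [isStair_self_iff]

lemma coverOp_fullRow {k b : ℕ} (hk : k < n) (hb : n - 1 - k ≤ b) :
    coverOp n R k b (fullRow n R (k + 1)) = 0 := by
  classical
  ext u
  rw [coverOp_apply, Pi.zero_apply]
  refine Finset.sum_eq_zero fun u' _ => ?_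
  split_ifs with h
  · obtain ⟨a, c, h1, h2, h3, h4, -, h6, h7⟩ := isLabeledCover_iff.1 h
    by_contra hne
    obtain ⟨-, hs⟩ := isStair_of_fullRow_ne_zero hk hne
    have := hs c (by omega) h3
    rw [h7, if_neg (by omega), if_pos rfl] at this
    omega
  · rfl

lemma isStair_of_nilProd_ne_zero {k t : ℕ} (hkt : k ≤ t) (x : R) {h : Perm' n → R}
    (hh : ∀ v, h v ≠ 0 → IsStair k t v) (m : ℕ) :
    ∀ i, t ≤ i → ∀ v, nilProd n x m i h v ≠ 0 → IsStair k t v := by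
  induction m with
  | zero => exact fun i _ v hv => hh v hv
  | succ m ih =>
    intro i hi v hv
    by_cases h1 : nilProd n x m (i + 1) h v = 0
    · classical
      have h2 : HasDescent v i ∧ nilProd n x m (i + 1) h (v * adjT n i) ≠ 0 := by
        by_contra hcon
        apply hv
        rw [nilProd, Module.End.mul_apply, LinearMap.add_apply, Module.End.one_apply,
          LinearMap.smul_apply, Pi.add_apply, Pi.smul_apply, nilGen_apply, h1, zero_add]
        split_ifs with hd
        · rw [of_not_not fun hne => hcon ⟨hd, hne⟩, smul_zero]
        · exact smul_zero _
      obtain ⟨s1, s2⟩ := ih (i + 1) (by omega) _ h2.2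
      have hj : ∀ j < t, oneLine (v * adjT n i) j = oneLine v j := fun j hj => by
        rw [oneLine_mul_adjT _ h2.1.1, if_neg (by omega), if_neg (by omega)]
      exact ⟨fun j hjk => by rw [← hj j (by omega), s1 j hjk],
        fun j hjk hjt => by rw [← hj j hjt, s2 j hjk hjt]⟩
    · exact ih (i + 1) (by omega) v h1

/-- The weighted sum over sequences of covers whose labels form a sublist of the given list,
each unused label `(k, b)` contributing a factor `x k`. -/
def chainSum (n : ℕ) {R : Type*} [CommRing R] (x : ℕ → R) : List (ℕ × ℕ) → Perm' n → R
  | [] => Pi.single (w0 n) 1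
  | l :: L => x l.1 • chainSum n x L + coverOp n R l.1 l.2 (chainSum n x L)

lemma chainSum_row_of_le (x : ℕ → R) {k d : ℕ} (hk : k < n) {s : R} {L : List (ℕ × ℕ)}
    (hL : chainSum n x L = s • rowProd n x d (k + 1) (fullRow n R (k + 1))) (e : ℕ) :
    ∀ b, n - 1 - k ≤ b → chainSum n x ((List.range' b e).map (Prod.mk k) ++ L) =
      (x k ^ e * s) • rowProd n x d (k + 1) (fullRow n R (k + 1)) := by
  induction e with
  | zero => intro b _; simp [hL]
  | succ e ih =>
    intro b hb
    have hc := LinearMap.congr_fun (commute_coverOp_rowProd (n := n) (k := k) (b := b) x d (k + 1)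
      (by omega)).eq (fullRow n R (k + 1))
    simp only [Module.End.mul_apply, coverOp_fullRow hk hb, map_zero] at hc
    rw [List.range'_succ, List.map_cons, List.cons_append, chainSum, ih (b + 1) (by omega),
      map_smul, hc, smul_zero, add_zero, smul_smul]
    congr 1
    ring

lemma chainSum_row (x : ℕ → R) {k d : ℕ} (hk : k < n) {s : R} {L : List (ℕ × ℕ)}
    (hL : chainSum n x L = s • rowProd n x d (k + 1) (fullRow n R (k + 1))) (e : ℕ) :
    ∀ b, b + e = n - 1 - k →
      chainSum n x ((List.range' b (e + (k + 1))).map (Prod.mk k) ++ L) =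
      (x k ^ (k + 1) * s) • rowProd n x d (k + 1)
        (nilRun n R k b (nilProd n (x k) e (k + b) (fullRow n R k))) := by
  induction e with
  | zero =>
    intro b hb
    rw [zero_add, chainSum_row_of_le x hk hL _ _ (by omega), fullRow, ← hb]
    rfl
  | succ e ih =>
    intro b hb
    set h := nilProd n (x k) e (k + (b + 1)) (fullRow n R k) with hh
    have hsupp : ∀ v, h v ≠ 0 → IsStair k (k + b + 1) v := by
      refine isStair_of_nilProd_ne_zero (by omega) (x k) (fun v hv => ?_) e _ (by omega)
      obtain ⟨s1, s2⟩ := isStair_of_fullRow_ne_zero hk.le hv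
      exact ⟨s1, fun j hj hj' => s2 j hj (by omega)⟩
    have hc := LinearMap.congr_fun (commute_coverOp_rowProd (n := n) (k := k) (b := b) x d (k + 1)
      (by omega)).eq (nilRun n R k (b + 1) h)
    simp only [Module.End.mul_apply] at hc
    rw [show e + 1 + (k + 1) = e + (k + 1) + 1 by omega, List.range'_succ, List.map_cons,
      List.cons_append, chainSum, ih (b + 1) (by omega), ← hh, map_smul, hc,
      coverOp_nilRun (by omega) hsupp]
    have hn : nilProd n (x k) (e + 1) (k + b) (fullRow n R k) =
        h + x k • nilGen n R (k + b) h := by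
      rw [nilProd, Module.End.mul_apply, LinearMap.add_apply, Module.End.one_apply,
        LinearMap.smul_apply]
      rfl
    rw [hn, nilRun, Module.End.mul_apply]
    simp only [map_add, map_smul, smul_add, smul_smul]
    rw [add_comm]
    congr 2
    ring

lemma chainSum_grid (x : ℕ → R) (d : ℕ) : ∀ k, k + d = n →
    chainSum n x ((List.range' k d).flatMap fun j => (List.range n).map (Prod.mk j)) =
      (∏ j ∈ Finset.Ico k n, x j ^ (j + 1)) • rowProd n x d k (fullRow n R k) := by
  induction d with
  | zero =>
    intro k hk
    obtain rfl : k = n := by omega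
    simp [chainSum, rowProd, fullRow_self]
  | succ d ih =>
    intro k hk
    have hkn : k < n := by omega
    have := chainSum_row x hkn (ih (k + 1) (by omega)) (n - 1 - k) 0 (by omega)
    rw [show n - 1 - k + (k + 1) = n by omega, ← List.range_eq_range'] at this
    rw [List.range'_succ, List.flatMap_cons, this, Finset.prod_eq_prod_Ico_succ_bot hkn]
    rfl

/-- The lexicographically sorted list of all labels `(k, b)` with `k, b < n`. -/
def labelGrid (n : ℕ) : List (ℕ × ℕ) :=
  (List.range n).flatMap fun j => (List.range n).map (Prod.mk j)

lemma chainSum_labelGrid (x : ℕ → R) :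
    chainSum n x (labelGrid n) =
      (∏ j : Fin n, x j ^ ((j : ℕ) + 1)) • rowProd n x n 0 (Pi.single 1 1) := by
  have := chainSum_grid (n := n) x n 0 (zero_add n)
  rwa [← List.range_eq_range', ← Finset.range_eq_Ico, Finset.prod_range] at this

lemma prod_labelGrid (x : ℕ → R) :
    ((labelGrid n).map fun l => x l.1).prod = ∏ j : Fin n, x j ^ n := by
  rw [← Finset.prod_range fun j => x j ^ n, labelGrid]
  have key : ∀ N, (((List.range N).flatMap fun j => (List.range n).map (Prod.mk j)).map
      fun l => x l.1).prod = ∏ j ∈ Finset.range N, x j ^ n := by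
    intro N
    induction N with
    | zero => simp
    | succ N ih =>
      rw [List.range_succ, List.flatMap_append, List.map_append, List.prod_append, ih,
        Finset.prod_range_succ]
      simp [Function.comp_def]
  exact key n

lemma HasDescent.invLength_lt {w : Perm' n} {i : ℕ} (h : HasDescent w i) :
    invLength (w * adjT n i) < invLength w := by
  obtain ⟨hi, hd⟩ := h
  have hin : i < n := by omega
  rw [oneLine_of_lt _ hi, oneLine_of_lt _ hin] at hd
  rw [adjT_of_lt hi]
  set a : Fin n := ⟨i, hin⟩ with ha
  set c : Fin n := ⟨i + 1, hi⟩ with hc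
  have hmem : (a, c) ∈ Finset.univ.filter (fun p : Fin n × Fin n => p.1 < p.2 ∧ w p.2 < w p.1) := by
    simp only [Finset.mem_filter, Finset.mem_univ, true_and]
    exact ⟨Nat.lt_succ_self i, hd⟩
  refine lt_of_le_of_lt ?_ (Finset.card_erase_lt_of_mem hmem)
  rw [invLength, ← Finset.card_map ((Equiv.swap a c).prodCongr (Equiv.swap a c)).toEmbedding]
  refine Finset.card_le_card fun q hq => ?_
  obtain ⟨⟨p, q⟩, hpq, rfl⟩ := Finset.mem_map.1 hq
  obtain ⟨-, hlt, hw⟩ := Finset.mem_filter.1 hpq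
  simp only [Equiv.Perm.mul_apply] at hlt hw
  simp only [Equiv.coe_toEmbedding, Equiv.prodCongr_apply, Prod.map_apply, Finset.mem_erase,
    Finset.mem_filter, Finset.mem_univ, true_and, ne_eq, Prod.mk.injEq]
  refine ⟨?_, ?_, hw⟩
  · rintro ⟨h1, h2⟩
    rw [Equiv.swap_apply_eq_iff, Equiv.swap_apply_left] at h1
    rw [Equiv.swap_apply_eq_iff, Equiv.swap_apply_right] at h2
    rw [h1, h2, Fin.lt_def] at hlt
    simp only [ha, hc] at hlt
    omega
  · by_contra hle
    have hpa : p = a ∧ q = c := by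
      rw [Equiv.swap_apply_def, Equiv.swap_apply_def] at hle
      rw [Fin.lt_def] at hlt
      split_ifs at hle <;> simp only [Fin.lt_def, Fin.ext_iff, ha, hc] at * <;> omega
    rw [hpa.1, hpa.2, Equiv.swap_apply_left, Equiv.swap_apply_right] at hw
    exact lt_asymm hw hd

lemma exists_hasDescent_mul_adjT {u : Perm' n} (hu : u ≠ w0 n) :
    ∃ i, i + 1 < n ∧ HasDescent (u * adjT n i) i := by
  by_contra hcon
  push Not at hcon
  have hdesc : ∀ i, i + 1 < n → oneLine u (i + 1) < oneLine u i := by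
    intro i hi
    have h1 := hcon i hi
    rw [hasDescent_mul_adjT _ hi, if_neg (by omega), if_pos rfl, if_pos rfl] at h1
    have h2 : oneLine u (i + 1) ≠ oneLine u i := fun h => by
      have := oneLine_injective u h
      omega
    have h3 : ¬ oneLine u i < oneLine u (i + 1) := fun h => h1 ⟨hi, h⟩
    omega
  have hle : ∀ j, j < n → oneLine u j + j ≤ n - 1 := by
    intro j
    induction j with
    | zero => intro h; have := oneLine_lt u h; omega
    | succ j ih => intro h; have := ih (by omega); have := hdesc j h; omega
  have hge : ∀ d j, j + d + 1 = n → d ≤ oneLine u j := by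
    intro d
    induction d with
    | zero => intro j _; omega
    | succ d ih => intro j hj; have := ih (j + 1) (by omega); have := hdesc j (by omega); omega
  refine hu ((isStair_self_iff u).1 ⟨fun j hj => ?_, fun j hj hj' => by omega⟩)
  have := hle j hj
  have := hge (n - 1 - j) j (by omega)
  omega

/-- The variable `x_k`, extended by zero. -/
def xVar (n k : ℕ) : MvPolynomial (Fin n) ℤ := if h : k < n then X ⟨k, h⟩ else 0

lemma xVar_coe (k : Fin n) : xVar n k = X k := by simp [xVar]

lemma rename_xVar {i : ℕ} (hi : i + 1 < n) (k : ℕ) :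
    rename (Equiv.swap (⟨i, by omega⟩ : Fin n) ⟨i + 1, hi⟩) (xVar n k) =
      xVar n (Equiv.swap i (i + 1) k) := by
  by_cases hk : k < n
  · have : Equiv.swap i (i + 1) k =
        (Equiv.swap (⟨i, by omega⟩ : Fin n) ⟨i + 1, hi⟩ ⟨k, hk⟩ : Fin n) := by
      rw [Equiv.swap_apply_def, Equiv.swap_apply_def]
      simp only [Fin.ext_iff]
      split_ifs <;> rfl
    rw [this, xVar_coe]
    simp [xVar, hk]
  · rw [Equiv.swap_apply_of_ne_of_ne (by omega) (by omega)]
    simp [xVar, hk]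

/-- The explicit product formula for Schubert polynomials in the nilCoxeter algebra. -/
def schubertProd (n : ℕ) : Perm' n → MvPolynomial (Fin n) ℤ :=
  rowProd n (xVar n) n 0 (Pi.single 1 1)

lemma schubertProd_sub_rename {w : Perm' n} {i : ℕ} (hi : i + 1 < n) (hd : HasDescent w i) :
    schubertProd n w - rename (Equiv.swap (⟨i, by omega⟩ : Fin n) ⟨i + 1, hi⟩) (schubertProd n w) =
      (X (⟨i, by omega⟩ : Fin n) - X ⟨i + 1, hi⟩) * schubertProd n (w * adjT n i) := by
  classical
  set φ : MvPolynomial (Fin n) ℤ →+* MvPolynomial (Fin n) ℤ :=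
    (rename (Equiv.swap (⟨i, by omega⟩ : Fin n) ⟨i + 1, hi⟩)).toRingHom with hφ
  have h1 := congrFun (map_rowProd φ (xVar n) n 0 (Pi.single (1 : Perm' n) 1)) w
  have h2 : φ ∘ xVar n = xVar n ∘ Equiv.swap i (i + 1) := funext fun k => rename_xVar hi k
  have h3 : φ ∘ (Pi.single 1 1 : Perm' n → MvPolynomial (Fin n) ℤ) = Pi.single 1 1 := by
    ext1 v
    rw [Function.comp_apply, Pi.single_apply]
    split_ifs <;> simp
  rw [h2, h3] at h1
  have h4 := congrFun (LinearMap.congr_fun (rowProd_sub_swap (xVar n) hi n 0 (by omega) (by omega))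
    (Pi.single 1 1)) w
  rw [LinearMap.sub_apply, Pi.sub_apply, ← h1, LinearMap.smul_apply, Pi.smul_apply,
    Module.End.mul_apply, nilGen_apply, if_pos hd, smul_eq_mul] at h4
  have h5 : xVar n i = X ⟨i, by omega⟩ := xVar_coe ⟨i, by omega⟩
  have h6 : xVar n (i + 1) = X ⟨i + 1, hi⟩ := xVar_coe ⟨i + 1, hi⟩
  rw [h5, h6] at h4
  exact h4

lemma chainSum_w0 (x : ℕ → R) (L : List (ℕ × ℕ)) :
    chainSum n x L (w0 n) = (L.map fun l => x l.1).prod := by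
  classical
  induction L with
  | nil => simp [chainSum]
  | cons l L ih =>
    have h0 : coverOp n R l.1 l.2 (chainSum n x L) (w0 n) = 0 := by
      rw [coverOp_apply]
      refine Finset.sum_eq_zero fun u' _ => if_neg fun h => ?_
      obtain ⟨a, c, hac, h, -⟩ := h
      rw [w0, Fin.revPerm_apply, Fin.revPerm_apply, Fin.rev_lt_rev] at h
      exact lt_asymm hac h
    rw [chainSum, Pi.add_apply, h0, Pi.smul_apply, ih, add_zero, List.map_cons, List.prod_cons,
      smul_eq_mul]

lemma prod_X_mul_xDelta (n : ℕ) :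
    (∏ j : Fin n, xVar n j ^ ((j : ℕ) + 1)) * xDelta n = ∏ j : Fin n, xVar n j ^ n := by
  rw [xDelta, ← Finset.prod_mul_distrib]
  refine Finset.prod_congr rfl fun j _ => ?_
  rw [xVar_coe, ← pow_add]
  congr 1
  omega

lemma prod_X_ne_zero (n : ℕ) : (∏ j : Fin n, xVar n j ^ ((j : ℕ) + 1)) ≠ 0 :=
  Finset.prod_ne_zero_iff.2 fun j _ => by
    rw [xVar_coe]
    exact pow_ne_zero _ (X_ne_zero j)

lemma schubertProd_w0 (n : ℕ) : schubertProd n (w0 n) = xDelta n := by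
  refine mul_left_cancel₀ (prod_X_ne_zero n) ?_
  rw [prod_X_mul_xDelta, ← prod_labelGrid, ← chainSum_w0, chainSum_labelGrid]
  rfl

theorem eq_schubertProd {S : Perm' n → MvPolynomial (Fin n) ℤ} (hS : IsSchubertFamily n S)
    (u : Perm' n) : S u = schubertProd n u := by
  have hbound : ∀ v : Perm' n, invLength v ≤ Fintype.card (Fin n × Fin n) := fun v =>
    Finset.card_le_univ _
  induction hN : Fintype.card (Fin n × Fin n) - invLength u using Nat.strong_induction_on
    generalizing u with
  | _ N ih =>
    by_cases hu : u = w0 n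
    · rw [hu, hS.1, schubertProd_w0]
    · obtain ⟨i, hi, hd⟩ := exists_hasDescent_mul_adjT hu
      have hlt := hd.invLength_lt
      have huu : u * adjT n i * adjT n i = u := by rw [mul_assoc, adjT_mul_self, mul_one]
      have hw : S (u * adjT n i) = schubertProd n (u * adjT n i) := by
        refine ih _ ?_ _ rfl
        have := hbound (u * adjT n i)
        rw [huu] at hlt
        omega
      have h1 := hS.2 (u * adjT n i) i hi (by rwa [← adjT_of_lt hi])
      have h2 := schubertProd_sub_rename hi hd
      rw [← adjT_of_lt hi, huu, hw] at h1
      rw [huu, ← adjT_of_lt hi] at h2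
      refine mul_left_cancel₀ ?_ (h1.symm.trans h2)
      rw [sub_ne_zero]
      intro hX
      have := X_injective hX
      simp at this

/-- A list of labels and permutations recording a path of labeled covers from `u` to `v`. -/
def IsPath (v : Perm' n) : Perm' n → List ((ℕ × ℕ) × Perm' n) → Prop
  | u, [] => u = v
  | u, s :: p => IsLabeledCover u s.2 s.1.1 s.1.2 ∧ IsPath v s.2 p

lemma IsPath.count_add_card_le {v : Perm' n} {k : ℕ} (hk : k < n)
    (p : List ((ℕ × ℕ) × Perm' n)) : ∀ (u : Perm' n) (T : Finset ℕ), IsPath v u p →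
      (p.map Prod.fst).Pairwise lexLt → (∀ s ∈ p, k ≤ s.1.1) →
      (∀ c ∈ T, k < c ∧ c < n) → (∀ c ∈ T, ∀ s ∈ p, s.1.1 = k → oneLine u c < s.1.2) →
      (p.map fun s => if s.1.1 = k then 1 else 0).sum + T.card ≤ n - 1 - k := by
  have hcard : ∀ T : Finset ℕ, (∀ c ∈ T, k < c ∧ c < n) → T.card ≤ n - 1 - k := by
    intro T hT
    have : T ⊆ Finset.Ico (k + 1) n := fun c hc => Finset.mem_Ico.2 ⟨(hT c hc).1, (hT c hc).2⟩
    refine (Finset.card_le_card this).trans ?_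
    rw [Nat.card_Ico]
    omega
  induction p with
  | nil => intro u T _ _ _ hT _; simpa using hcard T hT
  | cons s p ih =>
    intro u T hp hs hge hT hlt
    obtain ⟨hcov, hp⟩ := hp
    rw [List.map_cons, List.pairwise_cons] at hs
    obtain ⟨hhead, hs⟩ := hs
    have hhead' : ∀ t ∈ p, lexLt s.1 t.1 := fun t ht => hhead _ (List.mem_map_of_mem ht)
    by_cases hsk : s.1.1 = k
    · obtain ⟨a, c, h1, h2, h3, h4, -, h6, h7⟩ := isLabeledCover_iff.1 hcov
      have hcT : c ∉ T := fun hc => by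
        have := hlt c hc s (by simp) hsk
        omega
      have hs2 : ∀ t ∈ p, t.1.1 = k → s.1.2 < t.1.2 := fun t ht htk => by
        rcases hhead' t ht with h | h
        · omega
        · exact h.2
      have := ih s.2 (insert c T) hp hs (fun t ht => hge t (by simp [ht])) ?_ ?_
      · rw [Finset.card_insert_of_notMem hcT] at this
        rw [List.map_cons, List.sum_cons, if_pos hsk]
        omega
      · intro d hd
        rcases Finset.mem_insert.1 hd with rfl | hd
        · omega
        · exact hT d hd
      · intro d hd t ht htk
        have h8 := hs2 t ht htk
        rcases Finset.mem_insert.1 hd with rfl | hd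
        · rw [h7, if_neg (by omega), if_pos rfl]
          omega
        · have := hT d hd
          have hdc : d ≠ c := fun h => hcT (h ▸ hd)
          rw [h7, if_neg (by omega), if_neg hdc]
          exact hlt d hd t (by simp [ht]) htk
    · have hzero : ∀ t ∈ s :: p, t.1.1 ≠ k := by
        intro t ht
        have h1 := hge s (by simp)
        rcases List.mem_cons.1 ht with rfl | ht
        · exact hsk
        · have := hhead' t ht
          unfold lexLt at this
          omega
      have : ((s :: p).map fun s => if s.1.1 = k then 1 else 0).sum = 0 := by
        rw [List.sum_eq_zero]
        intro x hx
        obtain ⟨t, ht, rfl⟩ := List.mem_map.1 hx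
        rw [if_neg (hzero t ht)]
      rw [this, zero_add]
      exact hcard T hT

lemma IsPath.count_le {v : Perm' n} {k : ℕ} (hk : k < n) (p : List ((ℕ × ℕ) × Perm' n)) :
    ∀ u : Perm' n, IsPath v u p → (p.map Prod.fst).Pairwise lexLt →
      (p.map fun s => if s.1.1 = k then 1 else 0).sum ≤ n - 1 - k := by
  induction p with
  | nil => intro u _ _; simp
  | cons s p ih =>
    intro u hp hs
    by_cases hsk : s.1.1 < k
    · rw [List.map_cons, List.pairwise_cons] at hs
      rw [List.map_cons, List.sum_cons, if_neg (by omega), zero_add]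
      exact ih s.2 hp.2 hs.2
    · refine (IsPath.count_add_card_le hk (s :: p) u ∅ hp hs ?_ (by simp) (by simp))
      rw [List.map_cons, List.pairwise_cons] at hs
      intro t ht
      rcases List.mem_cons.1 ht with rfl | ht
      · omega
      · have := hs.1 _ (List.mem_map_of_mem ht)
        unfold lexLt at this
        omega

/-- The labels and permutations visited by a chain. -/
def chainPath {m : ℕ} {u v : Perm' n} (γ : LabeledChain n m u v) : List ((ℕ × ℕ) × Perm' n) :=
  List.ofFn fun i => (γ.lab i, γ.c i.succ)

lemma isPath_chainPath {m : ℕ} {u v : Perm' n} (γ : LabeledChain n m u v) :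
    IsPath v u (chainPath γ) := by
  have key : ∀ (m : ℕ) (c : Fin (m + 1) → Perm' n) (lab : Fin m → ℕ × ℕ),
      (∀ i : Fin m, IsLabeledCover (c i.castSucc) (c i.succ) (lab i).1 (lab i).2) →
      IsPath (c (Fin.last m)) (c 0) (List.ofFn fun i => (lab i, c i.succ)) := by
    intro m
    induction m with
    | zero => intro c lab _; exact rfl
    | succ m ih =>
      intro c lab h
      rw [List.ofFn_succ]
      exact ⟨h 0, ih (fun i => c i.succ) (fun i => lab i.succ) fun i => h i.succ⟩
  have := key m γ.c γ.lab γ.step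
  rwa [γ.c_last, γ.c_zero] at this

lemma exists_chainPath_eq {v : Perm' n} (p : List ((ℕ × ℕ) × Perm' n)) :
    ∀ u : Perm' n, IsPath v u p → ∃ (m : ℕ) (γ : LabeledChain n m u v), chainPath γ = p := by
  induction p with
  | nil =>
    rintro u rfl
    exact ⟨0, ⟨fun _ => u, Fin.elim0, rfl, rfl, fun i => i.elim0⟩, rfl⟩
  | cons s p ih =>
    rintro u ⟨h, hp⟩
    obtain ⟨m, γ, rfl⟩ := ih s.2 hp
    refine ⟨m + 1, ⟨Fin.cons u γ.c, Fin.cons s.1 γ.lab, rfl, ?_, ?_⟩, ?_⟩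
    · rw [← Fin.succ_last, Fin.cons_succ, γ.c_last]
    · intro i
      refine Fin.cases ?_ (fun i => ?_) i
      · rw [Fin.castSucc_zero, Fin.cons_zero, Fin.cons_succ, Fin.cons_zero, γ.c_zero]
        exact h
      · rw [← Fin.succ_castSucc, Fin.cons_succ, Fin.cons_succ, Fin.cons_succ]
        exact γ.step i
    · simp only [chainPath, List.ofFn_succ, Fin.cons_succ, Fin.cons_zero, γ.c_zero]

lemma chainPath_injective {m m' : ℕ} {u v : Perm' n} {γ : LabeledChain n m u v}
    {γ' : LabeledChain n m' u v} (h : chainPath γ = chainPath γ') : m = m' ∧ HEq γ γ' := by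
  obtain rfl : m = m' := by simpa [chainPath] using congrArg List.length h
  refine ⟨rfl, heq_of_eq ?_⟩
  have hf := List.ofFn_injective h
  obtain ⟨c, lab, h0, hl, hs⟩ := γ
  obtain ⟨c', lab', h0', hl', hs'⟩ := γ'
  have hlab : lab = lab' := funext fun i => congrArg Prod.fst (congrFun hf i)
  have hc : c = c' := by
    ext1 i
    refine Fin.cases (h0.trans h0'.symm) (fun i => ?_) i
    exact congrArg Prod.snd (congrFun hf i)
  subst hlab hc
  rfl

lemma pairwise_chainPath_iff {m : ℕ} {u v : Perm' n} (γ : LabeledChain n m u v) :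
    ((chainPath γ).map Prod.fst).Pairwise lexLt ↔ γ.Increasing := by
  rw [chainPath, List.map_ofFn, List.pairwise_ofFn]
  rfl

lemma chainType_eq_sum {m : ℕ} {u v : Perm' n} (γ : LabeledChain n m u v) (k : Fin n) :
    chainType γ k = ((chainPath γ).map fun s => if s.1.1 = (k : ℕ) then 1 else 0).sum := by
  rw [chainPath, List.map_ofFn, List.sum_ofFn, chainType, Finset.card_filter]
  rfl

lemma chainType_le {m : ℕ} {u v : Perm' n} (γ : LabeledChain n m u v) (hγ : γ.Increasing)
    (k : Fin n) : chainType γ k ≤ n - 1 - k := by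
  rw [chainType_eq_sum]
  exact IsPath.count_le k.2 _ u (isPath_chainPath γ) ((pairwise_chainPath_iff γ).2 hγ)

lemma prod_chainPath {m : ℕ} {u v : Perm' n} (γ : LabeledChain n m u v) :
    ((chainPath γ).map fun s => xVar n s.1.1).prod = monomial (chainTypeF γ) 1 := by
  have hlt : ∀ i, (γ.lab i).1 < n := fun i => by
    obtain ⟨a, c, -, -, -, -, -, h, -⟩ := γ.step i
    omega
  rw [chainPath, List.map_ofFn, List.prod_ofFn, monomial_eq, C_1, one_mul,
    Finsupp.prod_fintype _ _ fun _ => pow_zero _,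
    ← Finset.prod_fiberwise (s := Finset.univ) (g := fun i => (⟨(γ.lab i).1, hlt i⟩ : Fin n))]
  refine Finset.prod_congr rfl fun k _ => ?_
  have : chainTypeF γ k = (Finset.univ.filter fun i : Fin m =>
      (⟨(γ.lab i).1, hlt i⟩ : Fin n) = k).card := by
    simp only [Fin.ext_iff]
    rfl
  rw [this]
  refine Finset.prod_eq_pow_card fun i hi => ?_
  rw [← (Finset.mem_filter.1 hi).2, ← xVar_coe]
  rfl

open Classical in
/-- The paths of covers from a permutation to `w0` whose labels form a sublist of a given list. -/
def paths (n : ℕ) : List (ℕ × ℕ) → Perm' n → Finset (List ((ℕ × ℕ) × Perm' n))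
  | [], u => if u = w0 n then {[]} else ∅
  | l :: L, u => paths n L u ∪ (Finset.univ.filter fun u' => IsLabeledCover u u' l.1 l.2).biUnion
      fun u' => (paths n L u').image (List.cons (l, u'))

lemma mem_paths (L : List (ℕ × ℕ)) : ∀ (u : Perm' n) (p : List ((ℕ × ℕ) × Perm' n)),
    p ∈ paths n L u ↔ IsPath (w0 n) u p ∧ (p.map Prod.fst).Sublist L := by
  induction L with
  | nil =>
    intro u p
    rw [paths, List.sublist_nil, List.map_eq_nil_iff]
    split_ifs with h
    · rw [Finset.mem_singleton]
      exact ⟨fun hp => ⟨hp ▸ h, hp⟩, fun hp => hp.2⟩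
    · simp only [Finset.notMem_empty, false_iff]
      rintro ⟨hp, rfl⟩
      exact h hp
  | cons l L ih =>
    intro u p
    simp only [paths, Finset.mem_union, Finset.mem_biUnion, Finset.mem_filter, Finset.mem_univ,
      true_and, Finset.mem_image, ih]
    constructor
    · rintro (⟨h1, h2⟩ | ⟨u', hc, q, ⟨h1, h2⟩, rfl⟩)
      · exact ⟨h1, h2.cons l⟩
      · exact ⟨⟨hc, h1⟩, h2.cons_cons l⟩
    · rintro ⟨h1, h2⟩
      rcases p with _ | ⟨⟨l', u'⟩, q⟩
      · exact Or.inl ⟨h1, List.nil_sublist _⟩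
      · rw [List.map_cons] at h2
        cases h2 with
        | cons _ h2 => exact Or.inl ⟨h1, h2⟩
        | cons_cons _ h2 => exact Or.inr ⟨u', h1.1, q, ⟨h1.2, h2⟩, rfl⟩

/-- The product of the weights of the labels not used by a path. -/
def unusedProd (x : ℕ → R) : List (ℕ × ℕ) → List ((ℕ × ℕ) × Perm' n) → R
  | [], _ => 1
  | l :: L, [] => x l.1 * unusedProd x L []
  | l :: L, s :: p => if s.1 = l then unusedProd x L p else x l.1 * unusedProd x L (s :: p)

lemma unusedProd_mul (x : ℕ → R) (L : List (ℕ × ℕ)) : ∀ p : List ((ℕ × ℕ) × Perm' n),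
    (p.map Prod.fst).Sublist L →
      unusedProd x L p * (p.map fun s => x s.1.1).prod = (L.map fun l => x l.1).prod := by
  induction L with
  | nil =>
    intro p hp
    rw [List.sublist_nil, List.map_eq_nil_iff] at hp
    subst hp
    simp [unusedProd]
  | cons l L ih =>
    intro p hp
    rcases p with _ | ⟨s, p⟩
    · rw [unusedProd, mul_assoc, ih [] (List.nil_sublist _), List.map_cons, List.prod_cons]
    · rw [unusedProd, List.map_cons (l := L), List.prod_cons]
      rw [List.map_cons] at hp
      split_ifs with h
      · subst h
        rw [← ih p (List.cons_sublist_cons.1 hp), List.map_cons, List.prod_cons]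
        ring
      · rw [← ih (s :: p) (List.Sublist.of_cons_of_ne h hp), mul_assoc]

lemma chainSum_eq_sum_paths (x : ℕ → R) (L : List (ℕ × ℕ)) (hL : L.Nodup) :
    ∀ u : Perm' n, chainSum n x L u = ∑ p ∈ paths n L u, unusedProd x L p := by
  classical
  induction L with
  | nil =>
    intro u
    rw [chainSum, paths, Pi.single_apply]
    split_ifs <;> simp [unusedProd]
  | cons l L ih =>
    intro u
    obtain ⟨hl, hL⟩ := List.nodup_cons.1 hL
    have hne : ∀ (v : Perm' n) (u' : Perm' n) (q : List ((ℕ × ℕ) × Perm' n)),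
        (l, u') :: q ∉ paths n L v := fun v u' q hq => by
      have := ((mem_paths L v _).1 hq).2.subset
      exact hl (this (by simp))
    rw [chainSum, Pi.add_apply, Pi.smul_apply, coverOp_apply, paths, Finset.sum_union,
      Finset.sum_biUnion, ih hL, Finset.smul_sum, Finset.sum_filter]
    · congr 1
      · refine Finset.sum_congr rfl fun p hp => ?_
        rcases p with _ | ⟨⟨l', u'⟩, p⟩
        · rfl
        · rw [unusedProd, if_neg, smul_eq_mul]
          rintro rfl
          exact hne _ _ _ hp
      · refine Finset.sum_congr rfl fun u' _ => ?_
        rw [Finset.sum_image fun _ _ _ _ h => List.tail_eq_of_cons_eq h, ih hL]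
        simp [unusedProd]
    · intro u' _ u'' _ h
      rw [Function.onFun, Finset.disjoint_left]
      intro p hp hp'
      obtain ⟨q, -, rfl⟩ := Finset.mem_image.1 hp
      obtain ⟨q', -, hq⟩ := Finset.mem_image.1 hp'
      simp only [List.cons.injEq, Prod.mk.injEq, true_and] at hq
      exact h hq.1.symm
    · rw [Finset.disjoint_left]
      intro p hp hp'
      obtain ⟨u', -, hp'⟩ := Finset.mem_biUnion.1 hp'
      obtain ⟨q, -, rfl⟩ := Finset.mem_image.1 hp'
      exact hne _ _ _ hp

lemma mem_labelGrid {l : ℕ × ℕ} : l ∈ labelGrid n ↔ l.1 < n ∧ l.2 < n := by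
  obtain ⟨k, b⟩ := l
  simp [labelGrid]

lemma pairwise_labelGrid : (labelGrid n).Pairwise lexLt := by
  rw [labelGrid, List.pairwise_flatMap]
  refine ⟨fun k _ => ?_, List.pairwise_lt_range.imp fun h x hx y hy => ?_⟩
  · rw [List.pairwise_map]
    exact List.pairwise_lt_range.imp fun h => Or.inr ⟨rfl, h⟩
  · obtain ⟨b, -, rfl⟩ := List.mem_map.1 hx
    obtain ⟨c, -, rfl⟩ := List.mem_map.1 hy
    exact Or.inl h

lemma nodup_of_pairwise_lexLt {L : List (ℕ × ℕ)} (h : L.Pairwise lexLt) : L.Nodup :=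
  h.imp fun h heq => by
    subst heq
    unfold lexLt at h
    omega

lemma sublist_labelGrid_iff {u v : Perm' n} {p : List ((ℕ × ℕ) × Perm' n)} (hp : IsPath v u p) :
    (p.map Prod.fst).Sublist (labelGrid n) ↔ (p.map Prod.fst).Pairwise lexLt := by
  refine ⟨fun h => pairwise_labelGrid.sublist h, fun h => ?_⟩
  have : Std.Antisymm lexLt := ⟨fun a b h1 h2 => by
    unfold lexLt at h1 h2
    omega⟩
  refine List.sublist_of_subperm_of_pairwise
    (List.subperm_of_subset (nodup_of_pairwise_lexLt h) ?_) h pairwise_labelGrid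
  clear h
  induction p generalizing u with
  | nil => simp
  | cons s p ih =>
    rw [List.map_cons, List.cons_subset]
    refine ⟨mem_labelGrid.2 ?_, ih hp.2⟩
    obtain ⟨a, c, h1, h2, h3, -, -, h6, -⟩ := isLabeledCover_iff.1 hp.1
    have := oneLine_lt u (show a < n by omega)
    omega

lemma xDelta_eq_monomial (n : ℕ) : xDelta n = monomial (deltaF n) 1 := by
  rw [monomial_eq, C_1, one_mul, Finsupp.prod_fintype _ _ fun _ => pow_zero _]
  rfl

lemma unusedProd_chainPath {m : ℕ} {w : Perm' n} (γ : LabeledChain n m w (w0 n))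
    (hγ : γ.Increasing) : unusedProd (xVar n) (labelGrid n) (chainPath γ) =
      (∏ j : Fin n, xVar n j ^ ((j : ℕ) + 1)) * monomial (deltaF n - chainTypeF γ) 1 := by
  have hne : (monomial (chainTypeF γ) 1 : MvPolynomial (Fin n) ℤ) ≠ 0 := by simp
  refine mul_right_cancel₀ hne ?_
  have hle : chainTypeF γ ≤ deltaF n := fun k => chainType_le γ hγ k
  rw [← prod_chainPath, unusedProd_mul _ _ _
    ((sublist_labelGrid_iff (isPath_chainPath γ)).2 ((pairwise_chainPath_iff γ).2 hγ)),
    prod_labelGrid, ← prod_X_mul_xDelta, prod_chainPath, mul_assoc, monomial_mul,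
    tsub_add_cancel_of_le hle, mul_one, xDelta_eq_monomial]

theorem schubertProd_eq_finsum (w : Perm' n) : schubertProd n w =
    ∑ᶠ p : ((m : ℕ) × {γ : LabeledChain n m w (w0 n) // γ.Increasing}),
      (monomial (deltaF n - chainTypeF p.2.1) (1 : ℤ)) := by
  have hmem : ∀ p : ((m : ℕ) × {γ : LabeledChain n m w (w0 n) // γ.Increasing}),
      chainPath p.2.1 ∈ paths n (labelGrid n) w := fun p => (mem_paths _ _ _).2
    ⟨isPath_chainPath _, (sublist_labelGrid_iff (isPath_chainPath _)).2
      ((pairwise_chainPath_iff _).2 p.2.2)⟩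
  have hinj : ∀ p q : ((m : ℕ) × {γ : LabeledChain n m w (w0 n) // γ.Increasing}),
      chainPath p.2.1 = chainPath q.2.1 → p = q := by
    rintro ⟨m, γ, hγ⟩ ⟨m', γ', hγ'⟩ h
    obtain ⟨rfl, h⟩ := chainPath_injective h
    obtain rfl := eq_of_heq h
    rfl
  have : Finite ((m : ℕ) × {γ : LabeledChain n m w (w0 n) // γ.Increasing}) :=
    Finite.of_injective
      (fun p => (⟨chainPath p.2.1, hmem p⟩ : {p // p ∈ paths n (labelGrid n) w}))
      fun p q h => hinj p q (congrArg Subtype.val h)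
  have := Fintype.ofFinite ((m : ℕ) × {γ : LabeledChain n m w (w0 n) // γ.Increasing})
  rw [finsum_eq_sum_of_fintype]
  refine mul_left_cancel₀ (prod_X_ne_zero n) ?_
  have hsum := congrFun (chainSum_labelGrid (n := n) (xVar n)) w
  rw [Pi.smul_apply, smul_eq_mul, chainSum_eq_sum_paths _ _
    (nodup_of_pairwise_lexLt pairwise_labelGrid)] at hsum
  rw [schubertProd, ← hsum, Finset.mul_sum]
  symm
  refine Finset.sum_bij (fun p _ => chainPath p.2.1) (fun p _ => hmem p)
    (fun p _ q _ h => hinj p q h) (fun p hp => ?_)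
    fun p _ => (unusedProd_chainPath p.2.1 p.2.2).symm
  obtain ⟨h1, h2⟩ := (mem_paths _ _ _).1 hp
  obtain ⟨m, γ, rfl⟩ := exists_chainPath_eq p w h1
  exact ⟨⟨m, γ, (pairwise_chainPath_iff γ).1 ((sublist_labelGrid_iff h1).1 h2)⟩,
    Finset.mem_univ _, rfl⟩

end NilCoxeter

end SchubertChains

/-- For every `w ∈ Σ_n`, the Schubert polynomial satisfies
`S_w = ∑_{γ ∈ Γ(w,w₀)} x^δ / x^γ`, the sum over all increasing chains from `w` to `w₀`;
in particular, for each such chain `γ` the monomial `x^γ` divides `x^δ`. -/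
theorem schubert_eq_sum_increasing_chains (n : ℕ)
    (S : Perm' n → MvPolynomial (Fin n) ℤ) (hS : IsSchubertFamily n S)
    (w : Perm' n) :
    (∀ (m : ℕ) (γ : LabeledChain n m w (w0 n)), γ.Increasing →
        ∀ i : Fin n, chainType γ i ≤ n - 1 - (i : ℕ)) ∧
    S w = ∑ᶠ p : ((m : ℕ) × {γ : LabeledChain n m w (w0 n) // γ.Increasing}),
        (monomial (deltaF n - chainTypeF p.2.1) (1 : ℤ)) := by
  exact ⟨fun m γ hγ => SchubertChains.chainType_le γ hγ,
    (SchubertChains.eq_schubertProd hS w).trans (SchubertChains.schubertProd_eq_finsum w)⟩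
end
end

section
/- Let α = (α₁,…,α_{n−1}) be a composition with α_i ≤ n−i for all i. Then for every polynomial f ∈ ℤ[x₁,…,x_n], the coefficient of the monomial x^δ in NF(f · h_α) equals the coefficient of the monomial x^{δ−α} = x₁^{n−1−α₁}⋯x_{n−1}^{1−α_{n−1}} in NF(f). -/
open MvPolynomial

noncomputable section

/-- The monomial with exponent function `u`. -/
def expMonomial {n : ℕ} (u : Fin n → ℕ) : MvPolynomial (Fin n) ℤ := ∏ i, X i ^ u i

lemma expMonomial_add {n : ℕ} (u v : Fin n → ℕ) :
    expMonomial (u + v) = expMonomial u * expMonomial v := by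
  simp [expMonomial, pow_add, Finset.prod_mul_distrib]

lemma expMonomial_eq_monomial {n : ℕ} (u : Fin n → ℕ) :
    expMonomial u = monomial (Finsupp.equivFunOnFinite.symm u) 1 := by
  rw [monomial_eq, Finsupp.prod_fintype _ _ (by simp)]
  simp [expMonomial]

lemma monomial_eq_smul_expMonomial {n : ℕ} (d : Fin n →₀ ℕ) (c : ℤ) :
    monomial d c = c • expMonomial (⇑d) := by
  rw [expMonomial_eq_monomial, smul_monomial]
  simp

lemma rename_expMonomial {n : ℕ} (w : Equiv.Perm (Fin n)) (u : Fin n → ℕ) :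
    rename w (expMonomial u) = expMonomial (u ∘ w.symm) := by
  unfold expMonomial
  rw [map_prod, ← Equiv.prod_comp w fun i => X i ^ (u ∘ w.symm) i]
  simp

lemma prod_X_eq_expMonomial {n : ℕ} (S : Finset (Fin n)) :
    ∏ i ∈ S, X i = expMonomial fun i => if i ∈ S then 1 else 0 := by
  simp [expMonomial, Finset.prod_ite_mem, pow_ite]

/-- The coefficient of `x^δ` in the antisymmetrization of a polynomial. -/
def altCoeff (n : ℕ) : MvPolynomial (Fin n) ℤ →ₗ[ℤ] ℤ :=
  ∑ w : Equiv.Perm (Fin n), (Equiv.Perm.sign w : ℤ) •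
    (lcoeff ℤ (deltaF n) ∘ₗ (rename w).toLinearMap)

lemma altCoeff_apply (n : ℕ) (p : MvPolynomial (Fin n) ℤ) :
    altCoeff n p = ∑ w : Equiv.Perm (Fin n),
      (Equiv.Perm.sign w : ℤ) * coeff (deltaF n) (rename w p) := by
  simp [altCoeff]

lemma altCoeff_rename (n : ℕ) (v : Equiv.Perm (Fin n)) (p : MvPolynomial (Fin n) ℤ) :
    altCoeff n (rename v p) = (Equiv.Perm.sign v : ℤ) * altCoeff n p := by
  have h : (Equiv.Perm.sign v : ℤ) * (Equiv.Perm.sign v : ℤ) = 1 := by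
    rcases Int.units_eq_one_or (Equiv.Perm.sign v) with h | h <;> simp [h]
  rw [altCoeff_apply, altCoeff_apply,
    ← Equiv.sum_comp (Equiv.mulRight v) (fun w => (Equiv.Perm.sign w : ℤ) *
      coeff (deltaF n) (rename w p)), Finset.mul_sum]
  refine Finset.sum_congr rfl fun w _ => ?_
  have e : rename (⇑(w * v)) p = rename w (rename v p) := by
    rw [rename_rename]; rfl
  simp only [Equiv.coe_mulRight, e, Equiv.Perm.sign_mul, Units.val_mul]
  linear_combination (-(Equiv.Perm.sign w : ℤ) * coeff (deltaF n) (rename w (rename v p))) * h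

lemma altCoeff_eq_zero_of_swap {n : ℕ} {i j : Fin n} (hij : i ≠ j)
    {p : MvPolynomial (Fin n) ℤ} (hp : rename (Equiv.swap i j) p = p) : altCoeff n p = 0 := by
  have h := altCoeff_rename n (Equiv.swap i j) p
  rw [hp, Equiv.Perm.sign_swap hij] at h
  simp only [Units.val_neg, Units.val_one] at h
  linarith

lemma rename_swap_expMonomial {n : ℕ} {u : Fin n → ℕ} {i j : Fin n} (h : u i = u j) :
    rename (Equiv.swap i j) (expMonomial u) = expMonomial u := by
  rw [rename_expMonomial]
  congr 1
  ext k
  simp only [Equiv.symm_swap, Function.comp, Equiv.swap_apply_def]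
  split_ifs with h1 h2
  · rw [h1, h]
  · rw [h2, h]
  · rfl

lemma coeff_rename_expMonomial {n : ℕ} (w : Equiv.Perm (Fin n)) (u : Fin n → ℕ) :
    coeff (deltaF n) (rename w (expMonomial u)) =
      if ∀ i, u (w.symm i) = n - 1 - (i : ℕ) then 1 else 0 := by
  rw [rename_expMonomial, expMonomial_eq_monomial, coeff_monomial]
  refine if_congr ?_ rfl rfl
  rw [deltaF, Finsupp.equivFunOnFinite.symm.injective.eq_iff, funext_iff]
  rfl

lemma altCoeff_expMonomial_eq_zero {n : ℕ} {u : Fin n → ℕ}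
    (hu : ∀ w : Equiv.Perm (Fin n), ¬ ∀ i, u (w i) = n - 1 - (i : ℕ)) :
    altCoeff n (expMonomial u) = 0 := by
  rw [altCoeff_apply]
  refine Finset.sum_eq_zero fun w _ => ?_
  rw [coeff_rename_expMonomial, if_neg (hu w.symm), mul_zero]

lemma altCoeff_expMonomial {n : ℕ} {u : Fin n → ℕ} (hu : ∀ i, u i ≤ n - 1 - (i : ℕ)) :
    altCoeff n (expMonomial u) = if ∀ i, u i = n - 1 - (i : ℕ) then 1 else 0 := by
  split_ifs with h
  · rw [altCoeff_apply, Finset.sum_eq_single 1]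
    · have h1 : ∀ i, u ((1 : Equiv.Perm (Fin n)).symm i) = n - 1 - (i : ℕ) := h
      rw [coeff_rename_expMonomial, if_pos h1]
      simp
    · intro w _ hw
      rw [coeff_rename_expMonomial, if_neg, mul_zero]
      intro h'
      refine hw (Equiv.ext fun i => ?_)
      have h1 := h' (w i)
      rw [Equiv.symm_apply_apply, h i] at h1
      ext
      simp only [Equiv.Perm.coe_one, id]
      omega
    · simp
  · refine altCoeff_expMonomial_eq_zero fun w hw => h ?_
    have hs : ∑ i, u i = ∑ i : Fin n, (n - 1 - (i : ℕ)) := by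
      rw [← Equiv.sum_comp w]
      exact Finset.sum_congr rfl fun i _ => hw i
    simpa using (Finset.sum_eq_sum_iff_of_le fun i _ => hu i).1 hs

lemma altCoeff_expMonomial_mul_esymm {n k : ℕ} (hk : 1 ≤ k) (u : Fin n → ℕ) :
    altCoeff n (expMonomial u * esymm (Fin n) ℤ k) = 0 := by
  by_cases hu : Function.Injective u
  · rw [esymm, Finset.mul_sum, map_sum]
    refine Finset.sum_eq_zero fun S hS => ?_
    rw [prod_X_eq_expMonomial, ← expMonomial_add]
    refine altCoeff_expMonomial_eq_zero fun w hw => ?_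
    have hlt : ∀ i, u i < n := fun i => by
      have := hw (w.symm i)
      simp only [Pi.add_apply, Equiv.apply_symm_apply] at this
      have := i.isLt
      omega
    have hbij : Function.Bijective fun i => (⟨u i, hlt i⟩ : Fin n) :=
      Finite.injective_iff_bijective.1 fun i j h => hu (by simpa using h)
    have h1 : ∑ i, u i = ∑ i : Fin n, (i : ℕ) := hbij.sum_comp (fun i : Fin n => (i : ℕ))
    have h2 : ∑ i : Fin n, (i : ℕ) = ∑ i : Fin n, (n - 1 - (i : ℕ)) := by
      rw [← Equiv.sum_comp Fin.revPerm]
      exact Finset.sum_congr rfl fun i _ => by simp [Fin.val_rev]; omega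
    have h3 : ∑ i, (u + (fun i => if i ∈ S then 1 else 0) : Fin n → ℕ) i =
        ∑ i : Fin n, (n - 1 - (i : ℕ)) := by
      rw [← Equiv.sum_comp w]
      exact Finset.sum_congr rfl fun i _ => hw i
    simp only [Pi.add_apply, Finset.sum_add_distrib, Finset.sum_ite_mem, Finset.univ_inter,
      Finset.sum_const, (Finset.mem_powersetCard.1 hS).2, smul_eq_mul, mul_one] at h3
    omega
  · simp only [Function.Injective, not_forall] at hu
    obtain ⟨i, j, h, hij⟩ := hu
    refine altCoeff_eq_zero_of_swap hij ?_
    rw [map_mul, rename_swap_expMonomial h, esymm_isSymmetric]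

lemma altCoeff_eq_zero_of_mem {n : ℕ} {p : MvPolynomial (Fin n) ℤ} (hp : p ∈ symIdeal n) :
    altCoeff n p = 0 := by
  suffices ∀ q, altCoeff n (q * p) = 0 by simpa using this 1
  refine Submodule.span_induction (p := fun p _ => ∀ q, altCoeff n (q * p) = 0)
    ?_ ?_ ?_ ?_ hp
  · rintro _ ⟨k, hk, rfl⟩ q
    rw [q.as_sum, Finset.sum_mul, map_sum]
    refine Finset.sum_eq_zero fun d _ => ?_
    rw [monomial_eq_smul_expMonomial, smul_mul_assoc, map_smul, altCoeff_expMonomial_mul_esymm hk.1, smul_zero]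
  · simp
  · intro x y _ _ hx hy q
    rw [mul_add, map_add, hx, hy, add_zero]
  · intro a x _ hx q
    rw [smul_eq_mul, ← mul_assoc, hx]

lemma hpoly_zero_right (n k : ℕ) : hpoly n k 0 = 1 := by
  rw [hpoly, Finset.sym_zero, Finset.sum_singleton]
  rfl

lemma hpoly_zero_succ (n a : ℕ) : hpoly n 0 (a + 1) = 0 := by
  simp [hpoly]

lemma sum_sym_insert {ι R : Type*} [DecidableEq ι] [CommSemiring R] (f : ι → R)
    {s : Finset ι} {i : ι} (hi : i ∉ s) (a : ℕ) :
    ∑ m ∈ (insert i s).sym (a + 1), ((m : Multiset ι).map f).prod =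
      ∑ m ∈ s.sym (a + 1), ((m : Multiset ι).map f).prod +
        f i * ∑ m ∈ (insert i s).sym a, ((m : Multiset ι).map f).prod := by
  rw [← Finset.sum_filter_not_add_sum_filter _ (fun m => i ∈ m), Finset.mul_sum]
  congr 1
  · refine Finset.sum_congr ?_ fun _ _ => rfl
    ext m
    simp only [Finset.mem_filter, Finset.mem_sym_iff, Finset.mem_insert]
    constructor
    · rintro ⟨h, h'⟩ b hb
      exact (h b hb).resolve_left fun e => h' (e ▸ hb)
    · exact fun h => ⟨fun b hb => Or.inr (h b hb), fun h' => hi (h i h')⟩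
  · symm
    refine Finset.sum_bij (fun m _ => i ::ₛ m) ?_ ?_ ?_ ?_
    · intro m hm
      simp only [Finset.mem_filter, Finset.mem_sym_iff, Sym.mem_cons] at hm ⊢
      refine ⟨?_, by simp⟩
      rintro b (rfl | hb)
      · exact Finset.mem_insert_self _ _
      · exact hm b hb
    · intro m _ m' _ h
      simpa using h
    · intro m hm
      simp only [Finset.mem_filter, Finset.mem_sym_iff] at hm
      obtain ⟨m', rfl⟩ := Sym.exists_cons_of_mem hm.2
      exact ⟨m', Finset.mem_sym_iff.2 fun b hb => hm.1 b (Sym.mem_cons_of_mem hb), rfl⟩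
    · intro m _
      rw [Sym.coe_cons, Multiset.map_cons, Multiset.prod_cons]

lemma filter_lt_succ {n : ℕ} (k : Fin n) :
    (Finset.univ.filter fun i : Fin n => (i : ℕ) < k + 1) =
      insert k (Finset.univ.filter fun i : Fin n => (i : ℕ) < k) := by
  ext i
  simp [Fin.ext_iff]
  omega

lemma filter_le_eq_insert {n : ℕ} (k : Fin n) :
    (Finset.univ.filter fun i : Fin n => (k : ℕ) ≤ i) =
      insert k (Finset.univ.filter fun i : Fin n => (k : ℕ) + 1 ≤ i) := by
  ext i
  simp [Fin.ext_iff]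
  omega

lemma hpoly_succ_succ {n : ℕ} (k : Fin n) (a : ℕ) :
    hpoly n (k + 1) (a + 1) = hpoly n k (a + 1) + X k * hpoly n (k + 1) a := by
  unfold hpoly
  rw [filter_lt_succ]
  exact sum_sym_insert _ (by simp) a

/-- The elementary symmetric polynomial `e_a` in the variables of index at least `k`. -/
def tailEsymm (n k a : ℕ) : MvPolynomial (Fin n) ℤ :=
  ∑ S ∈ (Finset.univ.filter fun i : Fin n => k ≤ i).powersetCard a, ∏ i ∈ S, X i

lemma tailEsymm_succ {n : ℕ} (k : Fin n) (a : ℕ) :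
    tailEsymm n k (a + 1) = tailEsymm n (k + 1) (a + 1) + X k * tailEsymm n (k + 1) a := by
  have hk : k ∉ Finset.univ.filter fun i : Fin n => (k : ℕ) + 1 ≤ i := by simp
  have hS : ∀ S ∈ (Finset.univ.filter fun i : Fin n => (k : ℕ) + 1 ≤ i).powersetCard a,
      k ∉ S := fun S hS h => hk ((Finset.mem_powersetCard.1 hS).1 h)
  unfold tailEsymm
  rw [filter_le_eq_insert, Finset.powersetCard_succ_insert hk, Finset.sum_union, Finset.mul_sum,
    Finset.sum_image]
  · congr 1
    exact Finset.sum_congr rfl fun S h => Finset.prod_insert (hS S h)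
  · intro S h S' h' e
    rw [← Finset.erase_insert (hS S h), e, Finset.erase_insert (hS S' h')]
  · rw [Finset.disjoint_left]
    intro S h h'
    obtain ⟨T, -, rfl⟩ := Finset.mem_image.1 h'
    exact hk ((Finset.mem_powersetCard.1 h).1 (Finset.mem_insert_self _ _))

lemma tailEsymm_zero_right (n k : ℕ) : tailEsymm n k 0 = 1 := by
  simp [tailEsymm]

lemma tailEsymm_zero_mem (n a : ℕ) : tailEsymm n 0 (a + 1) ∈ symIdeal n := by
  have h : tailEsymm n 0 (a + 1) = esymm (Fin n) ℤ (a + 1) := by simp [tailEsymm, esymm]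
  rw [h]
  by_cases ha : a + 1 ≤ n
  · exact Ideal.subset_span ⟨a + 1, ⟨by omega, ha⟩, rfl⟩
  · rw [esymm, Finset.powersetCard_eq_empty.2 (by simpa using ha), Finset.sum_empty]
    exact zero_mem _

lemma hpoly_sub_tailEsymm_mem {n k : ℕ} (hk : k ≤ n) (a : ℕ) :
    hpoly n k a - (-1) ^ a * tailEsymm n k a ∈ symIdeal n := by
  induction k generalizing a with
  | zero =>
    cases a with
    | zero => simp [hpoly_zero_right, tailEsymm_zero_right]
    | succ a =>
      rw [hpoly_zero_succ, zero_sub]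
      exact neg_mem (Ideal.mul_mem_left _ _ (tailEsymm_zero_mem n a))
  | succ k ihk =>
    induction a with
    | zero => simp [hpoly_zero_right, tailEsymm_zero_right]
    | succ a iha =>
      have h1 := hpoly_succ_succ (⟨k, hk⟩ : Fin n) a
      have h2 := tailEsymm_succ (⟨k, hk⟩ : Fin n) a
      simp only at h1 h2
      have h := add_mem (ihk (by omega) (a + 1))
        (Ideal.mul_mem_left _ (X (⟨k, hk⟩ : Fin n)) iha)
      convert h using 1
      rw [h1, h2]
      ring

/-- Invariance under the permutations of the variables of index at least `k`. -/
def IsTailSymmetric {n : ℕ} (k : ℕ) (p : MvPolynomial (Fin n) ℤ) : Prop :=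
  ∀ i j : Fin n, k ≤ i → k ≤ j → rename (Equiv.swap i j) p = p

lemma IsTailSymmetric.mul {n k : ℕ} {p q : MvPolynomial (Fin n) ℤ}
    (hp : IsTailSymmetric k p) (hq : IsTailSymmetric k q) : IsTailSymmetric k (p * q) :=
  fun i j hi hj => by rw [map_mul, hp i j hi hj, hq i j hi hj]

lemma IsTailSymmetric.mono {n k l : ℕ} {p : MvPolynomial (Fin n) ℤ}
    (hp : IsTailSymmetric k p) (h : k ≤ l) : IsTailSymmetric l p :=
  fun i j hi hj => hp i j (h.trans hi) (h.trans hj)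

lemma isTailSymmetric_X_pow {n : ℕ} (k : Fin n) (b : ℕ) :
    IsTailSymmetric (k + 1) (X k ^ b : MvPolynomial (Fin n) ℤ) := fun i j hi hj => by
  rw [map_pow, rename_X, Equiv.swap_apply_of_ne_of_ne] <;>
  · rintro rfl
    omega

lemma isTailSymmetric_hpoly (n k a : ℕ) : IsTailSymmetric k (hpoly n k a) := fun i j hi hj => by
  unfold hpoly
  rw [map_sum]
  refine Finset.sum_congr rfl fun s hs => ?_
  rw [map_multiset_prod, Multiset.map_map]
  congr 1
  refine Multiset.map_congr rfl fun l hl => ?_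
  have hlk : (l : ℕ) < k := by simpa using Finset.mem_sym_iff.1 hs l hl
  rw [Function.comp, rename_X, Equiv.swap_apply_of_ne_of_ne] <;>
  · rintro rfl
    omega

lemma IsTailSymmetric.altCoeff_mul_expMonomial {n k : ℕ} {p : MvPolynomial (Fin n) ℤ}
    (hp : IsTailSymmetric k p) {u : Fin n → ℕ} {i j : Fin n} (hij : i ≠ j) (hi : k ≤ i)
    (hj : k ≤ j) (h : u i = u j) : altCoeff n (p * expMonomial u) = 0 :=
  altCoeff_eq_zero_of_swap hij (by rw [map_mul, hp i j hi hj, rename_swap_expMonomial h])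

/-- The part of the exponent `δ` at the positions of index at least `k`. -/
def tailDelta (n k : ℕ) : Fin n → ℕ := fun i => if k ≤ i then n - 1 - (i : ℕ) else 0

lemma X_pow_eq_expMonomial {n : ℕ} (k : Fin n) (b : ℕ) :
    (X k ^ b : MvPolynomial (Fin n) ℤ) = expMonomial (Pi.single k b) := by
  rw [expMonomial, Finset.prod_eq_single k]
  · simp
  · intro i _ h
    simp [h]
  · simp

lemma single_add_tailDelta {n : ℕ} (k : Fin n) :
    Pi.single k (n - 1 - (k : ℕ)) + tailDelta n (k + 1) = tailDelta n k := by
  ext i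
  simp only [tailDelta, Pi.add_apply, Pi.single_apply, Fin.ext_iff]
  split_ifs <;> omega

/-- The antisymmetrized coefficient kills `h_{a+1}(x₁, …, x_k)` times the part of `x^δ` in the
variables from `x_k` on. -/
lemma IsTailSymmetric.altCoeff_hpoly_succ {n : ℕ} {k : Fin n} {p : MvPolynomial (Fin n) ℤ}
    (hp : IsTailSymmetric k p) (a : ℕ) :
    altCoeff n (p * hpoly n (k + 1) (a + 1) * expMonomial (tailDelta n k)) = 0 := by
  have h := hpoly_sub_tailEsymm_mem (n := n) (k := k + 1) (by omega) (a + 1)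
  have h1 := altCoeff_eq_zero_of_mem (Ideal.mul_mem_left _ (p * expMonomial (tailDelta n k)) h)
  rw [mul_sub, map_sub, sub_eq_zero] at h1
  rw [mul_right_comm, h1, tailEsymm, Finset.mul_sum, Finset.mul_sum, map_sum]
  refine Finset.sum_eq_zero fun S hS => ?_
  rw [Finset.mem_powersetCard] at hS
  have hne : S.Nonempty := Finset.card_pos.1 (by omega)
  have hge : ∀ i ∈ S, (k : ℕ) + 1 ≤ i := fun i hi => by simpa using hS.1 hi
  set j := S.min' hne with hj
  have hjS : j ∈ S := S.min'_mem hne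
  have hkj := hge j hjS
  have hjn := j.isLt
  let i : Fin n := ⟨j - 1, by omega⟩
  have hi : i ∉ S := fun hi => by
    have : (j : ℕ) ≤ i := S.min'_le i hi
    simp only [i] at this
    omega
  have hS' : p * expMonomial (tailDelta n k) * ((-1) ^ (a + 1) * ∏ i ∈ S, X i) =
      ((-1 : ℤ) ^ (a + 1)) • (p * expMonomial (tailDelta n k +
        fun i => if i ∈ S then 1 else 0)) := by
    rw [expMonomial_add, prod_X_eq_expMonomial, zsmul_eq_mul]
    push_cast
    ring
  have hij : i ≠ j := fun e => hi (e ▸ hjS)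
  rw [hS', map_smul, hp.altCoeff_mul_expMonomial hij (by simp only [i]; omega) (by omega),
    smul_zero]
  simp only [Pi.add_apply, tailDelta, hi, hjS, if_true, if_false]
  rw [if_pos (by simp only [i]; omega), if_pos (by omega)]
  simp only [i]
  omega

lemma IsTailSymmetric.altCoeff_pow_mul_hpoly {n : ℕ} {k : Fin n} {p : MvPolynomial (Fin n) ℤ}
    (hp : IsTailSymmetric k p) {a b : ℕ} (hb : b ≤ n - 1 - (k : ℕ)) :
    altCoeff n (p * (X k ^ b * hpoly n (k + 1) a) * expMonomial (tailDelta n (k + 1))) =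
      if b + a = n - 1 - (k : ℕ) then altCoeff n (p * expMonomial (tailDelta n k)) else 0 := by
  have lower : ∀ {q : MvPolynomial (Fin n) ℤ} {c : ℕ}, IsTailSymmetric k q →
      c < n - 1 - (k : ℕ) →
      altCoeff n (q * X k ^ c * expMonomial (tailDelta n (k + 1))) = 0 := by
    intro q c hq hc
    rw [X_pow_eq_expMonomial, mul_assoc, ← expMonomial_add]
    have hl : n - 1 - c < n := by omega
    have hkl : k ≠ ⟨n - 1 - c, hl⟩ := fun e => by
      rw [Fin.ext_iff] at e
      simp only at e
      omega
    refine hq.altCoeff_mul_expMonomial hkl le_rfl (by simp only; omega) ?_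
    simp only [Pi.add_apply, Pi.single_eq_same, Pi.single_eq_of_ne hkl.symm, tailDelta]
    rw [if_neg (by omega), if_pos (by omega)]
    omega
  induction hb using Nat.decreasingInduction generalizing a with
  | self =>
    have e : p * (X k ^ (n - 1 - (k : ℕ)) * hpoly n (k + 1) a) *
        expMonomial (tailDelta n (k + 1)) =
        p * hpoly n (k + 1) a * expMonomial (tailDelta n k) := by
      rw [← single_add_tailDelta, expMonomial_add, X_pow_eq_expMonomial]
      ring
    rw [e]
    cases a with
    | zero => simp [hpoly_zero_right]
    | succ a => rw [hp.altCoeff_hpoly_succ, if_neg (by omega)]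
  | of_succ c hc ih =>
    cases a with
    | zero =>
      rw [hpoly_zero_right, mul_one, lower hp hc, if_neg (by omega)]
    | succ a =>
      have e : p * (X k ^ c * hpoly n (k + 1) (a + 1)) * expMonomial (tailDelta n (k + 1)) =
          (p * hpoly n k (a + 1)) * X k ^ c * expMonomial (tailDelta n (k + 1)) +
          p * (X k ^ (c + 1) * hpoly n (k + 1) a) * expMonomial (tailDelta n (k + 1)) := by
        rw [hpoly_succ_succ]
        ring
      rw [e, map_add, lower (hp.mul (isTailSymmetric_hpoly n k _)) hc, zero_add, ih]
      refine if_congr ?_ rfl rfl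
      omega

lemma IsTailSymmetric.altCoeff_tail {n k : ℕ} (hk : k ≤ n) {p : MvPolynomial (Fin n) ℤ}
    (hp : IsTailSymmetric k p) {u α : Fin n → ℕ} (hu : ∀ i, u i ≤ n - 1 - (i : ℕ)) :
    altCoeff n (p * ∏ i ∈ Finset.univ.filter (fun i : Fin n => k ≤ i),
        (X i ^ u i * hpoly n (i + 1) (α i))) =
      if ∀ i : Fin n, k ≤ i → u i + α i = n - 1 - (i : ℕ)
        then altCoeff n (p * expMonomial (tailDelta n k)) else 0 := by
  induction hk using Nat.decreasingInduction generalizing p with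
  | self =>
    have hn : ∀ i : Fin n, ¬ n ≤ i := fun i => by omega
    simp [hn, tailDelta, expMonomial]
  | of_succ k hk ih =>
    let κ : Fin n := ⟨k, hk⟩
    have hκ := filter_le_eq_insert κ
    simp only [κ] at hκ
    rw [hκ, Finset.prod_insert (by simp), ← mul_assoc]
    have hp' : IsTailSymmetric (k + 1) (p * (X κ ^ u κ * hpoly n (k + 1) (α κ))) :=
      (hp.mono (by omega)).mul
        ((isTailSymmetric_X_pow κ _).mul (isTailSymmetric_hpoly n (k + 1) _))
    rw [ih hp']
    have hp'' : IsTailSymmetric κ p := hp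
    have h := hp''.altCoeff_pow_mul_hpoly (a := α κ) (hu κ)
    simp only [κ] at h
    simp only [κ]
    rw [h, ← ite_and]
    refine if_congr ?_ rfl rfl
    constructor
    · rintro ⟨h1, h2⟩ i hi
      rcases hi.eq_or_lt with rfl | hi
      · exact h2
      · exact h1 i hi
    · exact fun h => ⟨fun i hi => h i (by omega), h _ le_rfl⟩

lemma altCoeff_expMonomial_mul_hAlpha {n : ℕ} {u : Fin n → ℕ} (α : Fin n → ℕ)
    (hu : ∀ i, u i ≤ n - 1 - (i : ℕ)) :
    altCoeff n (expMonomial u * hAlpha n α) =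
      if ∀ i, u i + α i = n - 1 - (i : ℕ) then 1 else 0 := by
  have h1 : IsTailSymmetric 0 (1 : MvPolynomial (Fin n) ℤ) := fun i j _ _ => map_one _
  have h := h1.altCoeff_tail (Nat.zero_le n) (α := α) hu
  rw [one_mul, one_mul, altCoeff_expMonomial (by simp [tailDelta])] at h
  simpa [Finset.prod_mul_distrib, tailDelta, expMonomial, hAlpha] using h

lemma altCoeff_eq_sum {n : ℕ} (g q : MvPolynomial (Fin n) ℤ) :
    altCoeff n (g * q) = ∑ d ∈ g.support, coeff d g * altCoeff n (expMonomial d * q) := by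
  conv_lhs => rw [g.as_sum]
  rw [Finset.sum_mul, map_sum]
  refine Finset.sum_congr rfl fun d _ => ?_
  rw [monomial_eq_smul_expMonomial, smul_mul_assoc, map_smul, smul_eq_mul]

lemma altCoeff_mul_hAlpha {n : ℕ} {α : Fin n → ℕ} (hα : ∀ i : Fin n, α i ≤ n - 1 - (i : ℕ))
    {g : MvPolynomial (Fin n) ℤ} (hg : ∀ d ∈ g.support, ∀ i : Fin n, d i ≤ n - 1 - (i : ℕ)) :
    altCoeff n (g * hAlpha n α) =
      coeff (Finsupp.equivFunOnFinite.symm fun i : Fin n => n - 1 - (i : ℕ) - α i) g := by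
  set e : Fin n →₀ ℕ := Finsupp.equivFunOnFinite.symm fun i : Fin n => n - 1 - (i : ℕ) - α i
    with he
  have hd : ∀ d ∈ g.support, coeff d g * altCoeff n (expMonomial d * hAlpha n α) =
      if d = e then coeff d g else 0 := fun d hd => by
    rw [altCoeff_expMonomial_mul_hAlpha α (hg d hd), mul_ite, mul_one, mul_zero]
    refine if_congr ?_ rfl rfl
    rw [Finsupp.ext_iff]
    refine forall_congr' fun i => ?_
    have h1 := hα i
    have h2 : e i = n - 1 - (i : ℕ) - α i := rfl
    omega
  rw [altCoeff_eq_sum, Finset.sum_congr rfl hd, Finset.sum_ite_eq']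
  split_ifs with h
  · rfl
  · exact (notMem_support_iff.1 h).symm

/-- For a composition `α` with `α_i ≤ n - i` and any polynomial `f`,
the coefficient of `x^δ` in `NF(f · h_α)` equals the coefficient of `x^{δ-α}` in `NF(f)`. -/
theorem coeff_xDelta_NF_mul_hAlpha (n : ℕ)
    (α : Fin n → ℕ) (hbd : ∀ i : Fin n, α i ≤ n - 1 - (i : ℕ))
    (f g g' : MvPolynomial (Fin n) ℤ)
    (hg : IsNormalForm n f g) (hg' : IsNormalForm n (f * hAlpha n α) g') :
    MvPolynomial.coeff (deltaF n) g'
      = MvPolynomial.coeff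
          (Finsupp.equivFunOnFinite.symm fun i : Fin n => n - 1 - (i : ℕ) - α i) g := by
  obtain ⟨hfg, hgδ⟩ := hg
  obtain ⟨hfg', hg'δ⟩ := hg'
  have h1 := altCoeff_mul_hAlpha (α := fun _ => 0) (fun _ => Nat.zero_le _) hg'δ
  simp only [hAlpha, hpoly_zero_right, Finset.prod_const_one, mul_one, Nat.sub_zero] at h1
  have hmem : g * hAlpha n α - g' ∈ symIdeal n := by
    have h := sub_mem hfg' (Ideal.mul_mem_right (hAlpha n α) _ hfg)
    convert h using 1
    ring
  have h2 := altCoeff_eq_zero_of_mem hmem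
  rw [map_sub, sub_eq_zero, altCoeff_mul_hAlpha hbd hgδ, h1] at h2
  exact h2.symm
end
end

section
/- Let w ∈ Σ_n, let R ∈ R(w) be an rc-graph associated to w, and let R = R₀ ⊂ R₁ ⊂ ⋯ ⊂ R_m (m = ℓ(w₀)−ℓ(w)) be the greedy sequence. Then w = w(R₀) ⋖ w(R₁) ⋖ ⋯ ⋖ w(R_m) = w₀ is a saturated chain in the Bruhat order on Σ_n. -/
open MvPolynomial

noncomputable section

/-! ### Adjacent transpositions and length -/

theorem adjT_val {n c : ℕ} (h : c + 1 < n) (x : Fin n) :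
    (adjT n c x : ℕ) = if (x : ℕ) = c then c + 1 else if (x : ℕ) = c + 1 then c else x := by
  simp only [adjT, h, dif_pos, Equiv.swap_apply_def, Fin.ext_iff]
  split_ifs <;> rfl

theorem invLength_one {n : ℕ} : invLength (1 : Perm' n) = 0 := by
  rw [invLength, Finset.card_eq_zero, Finset.filter_eq_empty_iff]
  rintro ⟨i, j⟩ - ⟨h₁, h₂⟩
  exact absurd h₁ h₂.asymm

theorem invLength_adjT_mul_le {n : ℕ} (c : ℕ) (v : Perm' n) :
    invLength (adjT n c * v) ≤ 1 + invLength v := by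
  by_cases h : c + 1 < n
  · rw [add_comm]
    refine le_trans (Finset.card_le_card ?_)
      (Finset.card_insert_le (v⁻¹ ⟨c, by omega⟩, v⁻¹ ⟨c + 1, h⟩) _)
    rintro ⟨i, j⟩ hij
    simp only [Finset.mem_insert, Finset.mem_filter, Finset.mem_univ, true_and, Prod.mk.injEq,
      Equiv.Perm.mul_apply, Equiv.Perm.eq_inv_iff_eq, Fin.ext_iff, Fin.lt_def,
      adjT_val h] at hij ⊢
    grind
  · simp [adjT, h]

/-- Multiplying on the left by `s_c` does not increase the length if `c + 1` occurs before `c`. -/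
theorem invLength_adjT_mul_le_of_lt {n c : ℕ} (v : Perm' n) (i j : Fin n) (hij : j < i)
    (h : c + 1 < n) (hi : (v i : ℕ) = c) (hj : (v j : ℕ) = c + 1) :
    invLength (adjT n c * v) ≤ invLength v := by
  refine Finset.card_le_card ?_
  rintro ⟨x, y⟩ hxy
  simp only [Finset.mem_filter, Finset.mem_univ, true_and, Equiv.Perm.mul_apply, Fin.lt_def,
    adjT_val h] at hxy ⊢
  have hi' : ∀ x, (v x : ℕ) = c → x = i := fun x hx => v.injective (Fin.ext (hx.trans hi.symm))
  have hj' : ∀ x, (v x : ℕ) = c + 1 → x = j := fun x hx => v.injective (Fin.ext (hx.trans hj.symm))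
  grind

theorem invLength_wordPerm_mul_le {n : ℕ} (l : List ℕ) (v : Perm' n) :
    invLength (wordPerm n l * v) ≤ l.length + invLength v := by
  induction l with
  | nil => simp [wordPerm]
  | cons a l ih =>
    have := invLength_adjT_mul_le a (wordPerm n l * v)
    simp only [wordPerm, List.map_cons, List.prod_cons, mul_assoc, List.length_cons] at *
    omega

/-- Transposing the values at an ascent `k < l` increases the length. -/
theorem invLength_lt_mul_swap {n : ℕ} (u : Perm' n) (k l : Fin n) (hkl : k < l) (hu : u k < u l) :
    invLength u < invLength (u * Equiv.swap k l) := by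
  set σ := Equiv.swap k l with hσ
  have hσ' : ∀ x, σ x = if x = k then l else if x = l then k else x := Equiv.swap_apply_def k l
  refine lt_of_le_of_lt (Finset.card_le_card_of_injOn
    (t := (Finset.univ.filter fun p : Fin n × Fin n =>
      p.1 < p.2 ∧ (u * σ) p.2 < (u * σ) p.1).erase (k, l))
    (fun p => if σ p.1 < σ p.2 then (σ p.1, σ p.2) else p) ?_ ?_)
    (Finset.card_erase_lt_of_mem ?_)
  · rintro ⟨i, j⟩ hij
    simp only [Finset.coe_filter, Finset.mem_univ, true_and, Set.mem_ofPred_eq] at hij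
    simp only [Finset.coe_erase, Set.mem_sdiff, Set.mem_singleton_iff, Equiv.Perm.mul_apply]
    grind
  · rintro ⟨i, j⟩ hij ⟨i', j'⟩ hij' h
    simp only [Finset.coe_filter, Finset.mem_univ, true_and, Set.mem_ofPred_eq] at hij hij'
    grind
  · simp [hσ, hkl, hu]

theorem invLength_le_invLength_w0 {n : ℕ} (w : Perm' n) : invLength w ≤ invLength (w0 n) := by
  refine Finset.card_le_card fun p hp => ?_
  simp only [Finset.mem_filter, Finset.mem_univ, true_and, w0, Fin.revPerm_apply,
    Fin.rev_lt_rev, and_self] at hp ⊢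
  exact hp.1

theorem eq_w0_of_invLength_eq {n : ℕ} (w : Perm' n) (h : invLength w = invLength (w0 n)) :
    w = w0 n := by
  have hsub : (Finset.univ.filter fun p : Fin n × Fin n => p.1 < p.2 ∧ w p.2 < w p.1) ⊆
      Finset.univ.filter fun p : Fin n × Fin n => p.1 < p.2 ∧ w0 n p.2 < w0 n p.1 := by
    intro p hp
    simp only [Finset.mem_filter, Finset.mem_univ, true_and, w0, Fin.revPerm_apply,
      Fin.rev_lt_rev, and_self] at hp ⊢
    exact hp.1
  have heq := Finset.eq_of_subset_of_card_le hsub h.ge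
  have hanti : StrictAnti w := fun i j hij => by
    have : (i, j) ∈ Finset.univ.filter fun p : Fin n × Fin n => p.1 < p.2 ∧ w p.2 < w p.1 := by
      rw [heq]; simp [w0, hij]
    simpa [hij] using this
  have hmono : StrictMono (w * w0 n) := fun i j hij =>
    hanti (by simpa [w0] using hij)
  have h1 : w * w0 n = 1 := Equiv.ext fun i => by
    have := (hmono.range_inj (g := (1 : Perm' n)) strictMono_id).1
      ((Equiv.range_eq_univ _).trans (Equiv.range_eq_univ _).symm)
    exact congrFun this i
  rw [eq_inv_of_mul_eq_one_left h1, inv_eq_iff_mul_eq_one]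
  ext i
  simp [w0]

/-! ### Permutations of ordered unions of position sets -/

theorem rcPerm_union {n : ℕ} (S T : Finset (ℕ × ℕ))
    (h : ∀ p ∈ S, ∀ q ∈ T, rcLE p q ∧ p ≠ q) : rcPerm n (S ∪ T) = rcPerm n S * rcPerm n T := by
  have hnd : (S.sort rcLE ++ T.sort rcLE).Nodup := by
    refine List.Nodup.append (S.sort_nodup _) (T.sort_nodup _) fun p hp hq => ?_
    exact (h p (by simpa using hp) p (by simpa using hq)).2 rfl
  have hsort : (S ∪ T).sort rcLE = S.sort rcLE ++ T.sort rcLE := by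
    have := (List.toFinset_sort (r := rcLE) hnd).2 (List.pairwise_append.2
      ⟨S.pairwise_sort _, T.pairwise_sort _, fun p hp q hq =>
        (h p (by simpa using hp) q (by simpa using hq)).1⟩)
    simpa [List.toFinset_append] using this
  simp [rcPerm, rcWord, wordPerm, hsort]

theorem rcPerm_singleton {n : ℕ} (p : ℕ × ℕ) : rcPerm n {p} = adjT n (p.1 + p.2) := by
  simp [rcPerm, rcWord, wordPerm]

theorem invLength_rcPerm_mul_le {n : ℕ} (S : Finset (ℕ × ℕ)) (v : Perm' n) :
    invLength (rcPerm n S * v) ≤ S.card + invLength v := by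
  exact (invLength_wordPerm_mul_le (rcWord S) v).trans (by simp [rcWord])

theorem invLength_rcPerm_le {n : ℕ} (S : Finset (ℕ × ℕ)) : invLength (rcPerm n S) ≤ S.card := by
  simpa [invLength_one] using invLength_rcPerm_mul_le S (1 : Perm' n)

theorem wordPerm_apply_of_lt {n k : ℕ} (l : List ℕ) (hl : ∀ a ∈ l, k ≤ a) (i : Fin n)
    (hi : (i : ℕ) < k) : wordPerm n l i = i := by
  induction l with
  | nil => rfl
  | cons a l ih =>
    have ha := hl a (by simp)
    have := ih fun b hb => hl b (by simp [hb])
    simp only [wordPerm, List.map_cons, List.prod_cons, Equiv.Perm.mul_apply] at this ⊢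
    rw [this]
    by_cases h : a + 1 < n
    · ext
      rw [adjT_val h]
      grind
    · simp [adjT, h]

theorem rcPerm_apply_of_lt {n k : ℕ} (S : Finset (ℕ × ℕ)) (hS : ∀ p ∈ S, k ≤ p.1) (i : Fin n)
    (hi : (i : ℕ) < k) : rcPerm n S i = i := by
  refine wordPerm_apply_of_lt _ (fun a ha => ?_) i hi
  simp only [rcWord, List.mem_map, Finset.mem_sort] at ha
  obtain ⟨p, hp, rfl⟩ := ha
  exact (hS p hp).trans (Nat.le_add_right _ _)

theorem le_rcPerm_apply {n k : ℕ} (S : Finset (ℕ × ℕ)) (hS : ∀ p ∈ S, k ≤ p.1) (i : Fin n)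
    (hi : k ≤ (i : ℕ)) : k ≤ (rcPerm n S i : ℕ) := by
  by_contra! h
  have := (rcPerm n S).injective (rcPerm_apply_of_lt S hS _ h)
  rw [this] at h
  omega

/-! ### Final segments of an rc-graph -/

/-- The positions of `R` from `(k, t - 1)` on in the order `rcLE`. -/
def rcTail (R : Finset (ℕ × ℕ)) (k t : ℕ) : Finset (ℕ × ℕ) :=
  R.filter fun p => k < p.1 ∨ (p.1 = k ∧ p.2 < t)

theorem mem_rcTail {R : Finset (ℕ × ℕ)} {k t : ℕ} {p : ℕ × ℕ} :
    p ∈ rcTail R k t ↔ p ∈ R ∧ (k < p.1 ∨ (p.1 = k ∧ p.2 < t)) := by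
  simp [rcTail]

theorem rcTail_succ_of_notMem {R : Finset (ℕ × ℕ)} {k t : ℕ} (h : (k, t) ∉ R) :
    rcTail R k (t + 1) = rcTail R k t := by
  ext ⟨j, a⟩
  simp only [mem_rcTail]
  grind

theorem rcTail_succ_of_mem {R : Finset (ℕ × ℕ)} {k t : ℕ} (h : (k, t) ∈ R) :
    rcTail R k (t + 1) = {(k, t)} ∪ rcTail R k t := by
  ext ⟨j, a⟩
  simp only [mem_rcTail, Finset.mem_union, Finset.mem_singleton, Prod.mk.injEq]
  grind

theorem rcPerm_rcTail_succ {n : ℕ} {R : Finset (ℕ × ℕ)} {k t : ℕ} (h : (k, t) ∈ R) :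
    rcPerm n (rcTail R k (t + 1)) = adjT n (k + t) * rcPerm n (rcTail R k t) := by
  rw [rcTail_succ_of_mem h, rcPerm_union, rcPerm_singleton]
  rintro p hp ⟨j, a⟩ hq
  rw [Finset.mem_singleton] at hp
  subst hp
  simp only [mem_rcTail] at hq
  simp only [rcLE, ne_eq, Prod.mk.injEq]
  omega

theorem card_rcTail_succ {R : Finset (ℕ × ℕ)} {k t : ℕ} (h : (k, t) ∈ R) :
    (rcTail R k (t + 1)).card = (rcTail R k t).card + 1 := by
  rw [rcTail_succ_of_mem h, ← Finset.insert_eq, Finset.card_insert_of_notMem]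
  simp [mem_rcTail]

theorem rcTail_zero {n : ℕ} {R : Finset (ℕ × ℕ)} (hR : IsRC n R) (k t : ℕ) (ht : n ≤ k + t + 2) :
    rcTail R k 0 = rcTail R (k + 1) t := by
  ext ⟨j, a⟩
  simp only [mem_rcTail]
  refine and_congr_right fun h => ?_
  have := hR _ h
  dsimp only at this
  omega

theorem rcTail_eq_self {n : ℕ} {R : Finset (ℕ × ℕ)} (hR : IsRC n R) (t : ℕ) (ht : n ≤ t + 1) :
    rcTail R 0 t = R := by
  ext ⟨j, a⟩
  simp only [mem_rcTail, and_iff_left_iff_imp]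
  intro h
  have := hR _ h
  dsimp only at this
  omega

theorem rcPerm_eq_mul_rcTail {n : ℕ} (R : Finset (ℕ × ℕ)) (k t : ℕ) :
    rcPerm n R = rcPerm n (R \ rcTail R k t) * rcPerm n (rcTail R k t) := by
  rw [← rcPerm_union,
    Finset.sdiff_union_of_subset (show rcTail R k t ⊆ R from Finset.filter_subset _ _)]
  rintro ⟨i, a⟩ hp ⟨j, b⟩ hq
  simp only [Finset.mem_sdiff, mem_rcTail] at hp hq
  simp only [rcLE, ne_eq, Prod.mk.injEq]
  grind

theorem card_rcTail_eq_invLength {n : ℕ} {R : Finset (ℕ × ℕ)}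
    (hlen : R.card = invLength (rcPerm n R)) (k t : ℕ) :
    (rcTail R k t).card = invLength (rcPerm n (rcTail R k t)) := by
  have h₁ := invLength_rcPerm_le (n := n) (rcTail R k t)
  have h₂ := invLength_rcPerm_mul_le (R \ rcTail R k t) (rcPerm n (rcTail R k t))
  rw [← rcPerm_eq_mul_rcTail] at h₂
  have h₃ := Finset.card_sdiff_add_card_eq_card
    (show rcTail R k t ⊆ R from Finset.filter_subset _ _)
  omega

/-- If row `k` starts with `t` consecutive positions, these act on values as a cycle. -/
theorem rcPerm_rcTail_val {n : ℕ} {R : Finset (ℕ × ℕ)} {k t : ℕ} (ht : k + t + 1 ≤ n)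
    (hrow : ∀ a < t, (k, a) ∈ R) (i : Fin n) :
    (rcPerm n (rcTail R k t) i : ℕ) =
      if (rcPerm n (rcTail R k 0) i : ℕ) = k then k + t
      else if k < (rcPerm n (rcTail R k 0) i : ℕ) ∧ (rcPerm n (rcTail R k 0) i : ℕ) ≤ k + t
        then rcPerm n (rcTail R k 0) i - 1 else rcPerm n (rcTail R k 0) i := by
  induction t with
  | zero => grind
  | succ t ih =>
    have ih := ih (by omega) fun a ha => hrow a (by omega)
    rw [rcPerm_rcTail_succ (hrow t (by omega)), Equiv.Perm.mul_apply, adjT_val (by omega), ih]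
    grind

/-- Full rows above row `k` shift all values at positions from `k` on. -/
theorem rcPerm_rcTail_add {n : ℕ} {R : Finset (ℕ × ℕ)} (hR : IsRC n R) {k : ℕ}
    (hfull : ∀ j a, j < k → j + a + 2 ≤ n → (j, a) ∈ R) (i : Fin n) (hi : k ≤ (i : ℕ))
    (d : ℕ) (hd : d ≤ k) :
    (rcPerm n (rcTail R (k - d) n) i : ℕ) + d = rcPerm n (rcTail R k n) i := by
  induction d with
  | zero => rfl
  | succ d ih =>
    have ih := ih (by omega)
    obtain ⟨j, hj⟩ : ∃ j, k - d = j + 1 := ⟨k - d - 1, by omega⟩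
    have hj' : k - (d + 1) = j := by omega
    have hi' := i.isLt
    rw [hj, ← rcTail_zero hR j n (by omega)] at ih
    have hle : j + 1 ≤ (rcPerm n (rcTail R j 0) i : ℕ) := by
      refine le_rcPerm_apply _ (fun p hp => ?_) i (by omega)
      rw [mem_rcTail] at hp
      omega
    have hrow := rcPerm_rcTail_val (R := R) (k := j) (t := n - 1 - j) (n := n) (by omega)
      (fun a ha => hfull j a (by omega) (by omega)) i
    have htail : rcTail R j n = rcTail R j (n - 1 - j) := by
      ext ⟨x, a⟩
      simp only [mem_rcTail]
      refine and_congr_right fun h => ?_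
      have := hR _ h
      dsimp only at this
      omega
    have hlt := (rcPerm n (rcTail R j 0) i).isLt
    rw [hj', htail, hrow]
    grind

/-! ### One greedy step -/

theorem greedyStep_bruhatCover {n : ℕ} {R R' : Finset (ℕ × ℕ)} (hR : IsRC n R)
    (hlen : R.card = invLength (rcPerm n R)) (hstep : GreedyStep n R R') :
    BruhatCover (rcPerm n R) (rcPerm n R') ∧ IsRC n R' ∧ R'.card = R.card + 1 ∧
      R'.card = invLength (rcPerm n R') := by
  obtain ⟨⟨k, b⟩, hp, hv, hmin, rfl⟩ := hstep
  dsimp only at hv hmin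
  have hfull : ∀ j a, j < k → j + a + 2 ≤ n → (j, a) ∈ R := by
    intro j a hj ha
    by_contra h
    have := hmin (j, a) ha h
    dsimp only at this
    omega
  have hrow : ∀ a < b, (k, a) ∈ R := by
    intro a ha
    by_contra h
    have := hmin (k, a) (by dsimp only; omega) h
    dsimp only at this
    omega
  set y := rcPerm n (rcTail R k b) with hy
  set κ : Fin n := ⟨k, by omega⟩ with hκ
  set l : Fin n := y⁻¹ ⟨k + b + 1, by omega⟩ with hl
  have hyl : y l = ⟨k + b + 1, by omega⟩ := by simp [hl]
  have hyκ : y κ = ⟨k + b, by omega⟩ := by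
    have h0 : rcPerm n (rcTail R k 0) κ = κ :=
      rcPerm_apply_of_lt (k := k + 1) _ (fun p hp => by rw [mem_rcTail] at hp; omega) κ
        (Nat.lt_succ_self k)
    ext
    rw [hy, rcPerm_rcTail_val (by omega) hrow, h0]
    simp [hκ]
  have hκl : κ < l := by
    rcases lt_trichotomy l κ with h | h | h
    · have : y l = l :=
        rcPerm_apply_of_lt (k := k) _ (fun p hp => by rw [mem_rcTail] at hp; omega) l h
      rw [hyl] at this
      rw [← this] at h
      simp [hκ, Fin.lt_def] at h
      omega
    · rw [h, hyκ] at hyl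
      simp at hyl
    · exact h
  have hinv : ∀ t, ∃ c, k + b < c ∧ c ≤ k + (b + 1 + t) ∧
      (rcPerm n (rcTail R k (b + 1 + t)) κ : ℕ) = k + b ∧
      (rcPerm n (rcTail R k (b + 1 + t)) l : ℕ) = c ∧
      ∀ i, κ < i → i < l → ¬ (k + b < (rcPerm n (rcTail R k (b + 1 + t)) i : ℕ) ∧
        (rcPerm n (rcTail R k (b + 1 + t)) i : ℕ) < c) := by
    intro t
    induction t with
    | zero =>
      rw [add_zero, rcTail_succ_of_notMem hp, ← hy]
      exact ⟨k + b + 1, by omega, by omega, by rw [hyκ], by rw [hyl], fun i _ _ => by omega⟩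
    | succ t ih =>
      obtain ⟨c, hc, hct, hκ', hl', hbetween⟩ := ih
      rw [← add_assoc (b + 1) t 1]
      by_cases hmem : (k, b + 1 + t) ∈ R
      · have hval := hR _ hmem
        dsimp only at hval
        have hc₁ := card_rcTail_succ hmem
        rw [card_rcTail_eq_invLength hlen, card_rcTail_eq_invLength hlen,
          rcPerm_rcTail_succ hmem] at hc₁
        rw [rcPerm_rcTail_succ hmem]
        set v := rcPerm n (rcTail R k (b + 1 + t))
        simp only [Equiv.Perm.mul_apply, adjT_val (show k + (b + 1 + t) + 1 < n by omega)]
        have hasc : ∀ i, (v i : ℕ) = k + (b + 1 + t) + 1 → k + (b + 1 + t) = c → ¬ i < l := by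
          intro i hi hcc hil
          have := invLength_adjT_mul_le_of_lt v l i hil (by omega) (hl'.trans hcc.symm) hi
          omega
        by_cases hcc : k + (b + 1 + t) = c
        · exact ⟨c + 1, by grind, by grind, by grind, by grind, by grind⟩
        · exact ⟨c, by grind, by grind, by grind, by grind, by grind⟩
      · rw [rcTail_succ_of_notMem hmem]
        exact ⟨c, hc, by omega, hκ', hl', hbetween⟩
  have hshift : ∀ i, κ ≤ i → (rcPerm n R i : ℕ) + k = rcPerm n (rcTail R k n) i := by
    intro i hi
    have := rcPerm_rcTail_add hR hfull i hi k le_rfl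
    rwa [Nat.sub_self, rcTail_eq_self hR n (by omega)] at this
  obtain ⟨c, hc, -, hκ', hl', hbetween⟩ := hinv (n - (b + 1))
  rw [show b + 1 + (n - (b + 1)) = n by omega] at hκ' hl' hbetween
  have hmul : rcPerm n (insert (k, b) R) = rcPerm n R * Equiv.swap κ l := by
    have htail : rcTail (insert (k, b) R) k b = rcTail R k b := by
      ext ⟨j, a⟩
      simp only [mem_rcTail, Finset.mem_insert, Prod.mk.injEq]
      grind
    have hhead : insert (k, b) R \ rcTail (insert (k, b) R) k (b + 1) = R \ rcTail R k b := by
      ext ⟨j, a⟩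
      simp only [mem_rcTail, Finset.mem_insert, Finset.mem_sdiff, Prod.mk.injEq]
      grind
    rw [rcPerm_eq_mul_rcTail (insert (k, b) R) k (b + 1), hhead,
      rcPerm_rcTail_succ (Finset.mem_insert_self _ _), htail, rcPerm_eq_mul_rcTail R k b,
      mul_assoc, ← hy, Equiv.mul_swap_eq_swap_mul, hyκ, hyl, adjT, dif_pos]
  have hκs := hshift κ le_rfl
  have hls := hshift l hκl.le
  have hasc : rcPerm n R κ < rcPerm n R l := by
    rw [Fin.lt_def]
    omega
  have hcard : (insert (k, b) R).card = R.card + 1 := Finset.card_insert_of_notMem hp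
  refine ⟨⟨κ, l, hκl, hasc, fun i hi hil h => ?_, hmul⟩, ?_, hcard, le_antisymm ?_ ?_⟩
  · have his := hshift i hi.le
    have := hbetween i hi hil
    simp only [Fin.lt_def] at h
    omega
  · intro q hq
    rcases Finset.mem_insert.1 hq with rfl | hq
    · exact hv
    · exact hR q hq
  · have := invLength_lt_mul_swap _ κ l hκl hasc
    rw [hcard, hmul]
    omega
  · exact invLength_rcPerm_le _

/-- For an rc-graph `R ∈ 𝓡(w)` with greedy sequence
`R = R₀ ⊂ ⋯ ⊂ R_m` (`m = ℓ(w₀) - ℓ(w)`), the permutations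
`w = w(R₀) ⋖ w(R₁) ⋖ ⋯ ⋖ w(R_m) = w₀` form a saturated chain in Bruhat order. -/
theorem greedy_sequence_saturated_chain (n : ℕ) (w : Perm' n) (R : Finset (ℕ × ℕ)) (hR : AssocRC n R w)
    (Rs : ℕ → Finset (ℕ × ℕ)) (hR0 : Rs 0 = R)
    (hstep : ∀ i < invLength (w0 n) - invLength w, GreedyStep n (Rs i) (Rs (i + 1))) :
    rcPerm n (Rs 0) = w ∧
    rcPerm n (Rs (invLength (w0 n) - invLength w)) = w0 n ∧
    (∀ i < invLength (w0 n) - invLength w,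
      BruhatCover (rcPerm n (Rs i)) (rcPerm n (Rs (i + 1)))) := by
  obtain ⟨hRC, hw, hcard⟩ := hR
  subst hR0
  set m := invLength (w0 n) - invLength w with hm
  have hinv : ∀ i ≤ m, IsRC n (Rs i) ∧ (Rs i).card = invLength (rcPerm n (Rs i)) ∧
      (Rs i).card = invLength w + i := by
    intro i
    induction i with
    | zero => exact fun _ => ⟨hRC, by rw [hw, hcard], hcard⟩
    | succ i ih =>
      intro hi
      obtain ⟨h₁, h₂, h₃⟩ := ih (by omega)
      obtain ⟨-, h₄, h₅, h₆⟩ := greedyStep_bruhatCover h₁ h₂ (hstep i (by omega))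
      exact ⟨h₄, h₆, by omega⟩
  refine ⟨hw, ?_, fun i hi => ?_⟩
  · obtain ⟨-, h₁, h₂⟩ := hinv m le_rfl
    have := invLength_le_invLength_w0 w
    exact eq_w0_of_invLength_eq _ (by omega)
  · obtain ⟨h₁, h₂, -⟩ := hinv i hi.le
    exact (greedyStep_bruhatCover h₁ h₂ (hstep i hi)).1
end
end
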